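/- arXiv:1802.02019 — 2 statements merged into one kernel-verified Lean document; each statement's English description precedes it below -/
import Mathlib

section
/- Suppose the solution to the parameter-dependent boundary-value problem L(ε)y = f(·,ε), B(ε)y = c(ε) depends continuously on the parameter ε at ε = 0, i.e., conditions (∗) and (∗∗) hold. Then ‖B(ε)‖ = O(1) as ε → 0+, i.e., there exist K > 0 and ε' ∈ (0, ε₀) such that ‖B(ε)‖ ≤ K for all ε ∈ (0, ε'), where ‖B(ε)‖ denotes the norm of the bounded operator B(ε) : (C^{n+r,α})^m → ℂ^{rm}. -/
open Set Filter Topology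

noncomputable section

/-- `x` belongs to the Hölder space `C^{n,α}([a,b],ℂ)`: it is `n` times continuously
differentiable on `[a,b]` and the Hölder seminorm of `x⁽ⁿ⁾` is finite. -/
def HolMem (a b : ℝ) (n : ℕ) (α : ℝ) (x : ℝ → ℂ) : Prop :=
  ContDiffOn ℝ n x (Set.Icc a b) ∧
    ∃ C : ℝ, ∀ t₁ ∈ Set.Icc a b, ∀ t₂ ∈ Set.Icc a b, t₁ < t₂ →
      ‖iteratedDerivWithin n x (Set.Icc a b) t₂ - iteratedDerivWithin n x (Set.Icc a b) t₁‖ ≤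
        C * (t₂ - t₁) ^ α

/-- The Hölder seminorm `‖x‖'_{n,α}`. -/
def holSemiNorm (a b : ℝ) (n : ℕ) (α : ℝ) (x : ℝ → ℂ) : ℝ :=
  sSup { s : ℝ | ∃ t₁ ∈ Set.Icc a b, ∃ t₂ ∈ Set.Icc a b, t₁ < t₂ ∧
    s = ‖iteratedDerivWithin n x (Set.Icc a b) t₂ - iteratedDerivWithin n x (Set.Icc a b) t₁‖ /
        (t₂ - t₁) ^ α }

/-- The Hölder norm `‖x‖_{n,α} = ∑_{j=0}^n max_{[a,b]} |x⁽ʲ⁾| + ‖x‖'_{n,α}`. -/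
def holNorm (a b : ℝ) (n : ℕ) (α : ℝ) (x : ℝ → ℂ) : ℝ :=
  (∑ j ∈ Finset.range (n + 1),
      sSup { s : ℝ | ∃ t ∈ Set.Icc a b, s = ‖iteratedDerivWithin j x (Set.Icc a b) t‖ }) +
    holSemiNorm a b n α x

/-- Vector-valued Hölder class `(C^{n,α})^k`. -/
def vHolMem (a b : ℝ) (n : ℕ) (α : ℝ) {k : ℕ} (x : ℝ → (Fin k → ℂ)) : Prop :=
  ∀ i, HolMem a b n α (fun t => x t i)

/-- Norm on `(C^{n,α})^k`: the sum of the norms of the entries. -/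
def vHolNorm (a b : ℝ) (n : ℕ) (α : ℝ) {k : ℕ} (x : ℝ → (Fin k → ℂ)) : ℝ :=
  ∑ i, holNorm a b n α (fun t => x t i)

/-- Matrix-valued Hölder class `(C^{n,α})^{k×l}`. -/
def mHolMem (a b : ℝ) (n : ℕ) (α : ℝ) {k l : ℕ} (X : ℝ → Matrix (Fin k) (Fin l) ℂ) : Prop :=
  ∀ i j, HolMem a b n α (fun t => X t i j)

/-- Norm on `(C^{n,α})^{k×l}`: the sum of the norms of the entries. -/
def mHolNorm (a b : ℝ) (n : ℕ) (α : ℝ) {k l : ℕ} (X : ℝ → Matrix (Fin k) (Fin l) ℂ) : ℝ :=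
  ∑ i, ∑ j, holNorm a b n α (fun t => X t i j)

/-- Entrywise `p`-th derivative of a vector-valued function on `[a,b]`. -/
def vDeriv (a b : ℝ) (p : ℕ) {k : ℕ} (y : ℝ → (Fin k → ℂ)) : ℝ → (Fin k → ℂ) :=
  fun t i => iteratedDerivWithin p (fun s => y s i) (Set.Icc a b) t

/-- Entrywise `p`-th derivative of a matrix-valued function on `[a,b]`. -/
def mDeriv (a b : ℝ) (p : ℕ) {k l : ℕ} (Y : ℝ → Matrix (Fin k) (Fin l) ℂ) :
    ℝ → Matrix (Fin k) (Fin l) ℂ :=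
  fun t i j => iteratedDerivWithin p (fun s => Y s i j) (Set.Icc a b) t

/-- The differential expression `(L y)(t) = y⁽ʳ⁾(t) + ∑_{j=1}^r A_{r-j}(t) y⁽ʳ⁻ʲ⁾(t)`;
here `A j` denotes the coefficient matrix of `y⁽ʲ⁾`, for `0 ≤ j ≤ r-1`. -/
def Lop (a b : ℝ) (r : ℕ) {m : ℕ} (A : Fin r → ℝ → Matrix (Fin m) (Fin m) ℂ)
    (y : ℝ → (Fin m → ℂ)) : ℝ → (Fin m → ℂ) :=
  fun t => vDeriv a b r y t + ∑ j : Fin r, (A j t).mulVec (vDeriv a b (j : ℕ) y t)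

/-- The matrix analogue of `Lop`, applied to matrix-valued functions. -/
def LopM (a b : ℝ) (r : ℕ) {m k : ℕ} (A : Fin r → ℝ → Matrix (Fin m) (Fin m) ℂ)
    (Z : ℝ → Matrix (Fin m) (Fin k) ℂ) : ℝ → Matrix (Fin m) (Fin k) ℂ :=
  fun t => mDeriv a b r Z t + ∑ j : Fin r, A j t * mDeriv a b (j : ℕ) Z t

/-- `y` is a solution in `(C^{n+r,α})^m` of the problem `L y = f` on `[a,b]`, `B y = c`. -/
def IsSol (a b : ℝ) (n : ℕ) (α : ℝ) (r m : ℕ)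
    (A : Fin r → ℝ → Matrix (Fin m) (Fin m) ℂ)
    (B : (ℝ → (Fin m → ℂ)) →ₗ[ℂ] (Fin (r * m) → ℂ))
    (f : ℝ → (Fin m → ℂ)) (c : Fin (r * m) → ℂ) (y : ℝ → (Fin m → ℂ)) : Prop :=
  vHolMem a b (n + r) α y ∧ (∀ t ∈ Set.Icc a b, Lop a b r A y t = f t) ∧ B y = c

/-- Limit Condition (I): `A_{r-j}(·,ε) → A_{r-j}(·,0)` in `(C^{n,α})^{m×m}` as `ε → 0+`. -/
def CondI (a b : ℝ) (n : ℕ) (α : ℝ) (r m : ℕ)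
    (A : ℝ → Fin r → ℝ → Matrix (Fin m) (Fin m) ℂ) : Prop :=
  ∀ j : Fin r,
    Tendsto (fun ε => mHolNorm a b n α (fun t => A ε j t - A 0 j t))
      (nhdsWithin 0 (Set.Ioi 0)) (nhds 0)

/-- Limit Condition (II): `B(ε)y → B(0)y` in `ℂ^{rm}` as `ε → 0+`,
for every `y ∈ (C^{n+r,α})^m`. -/
def CondII (a b : ℝ) (n : ℕ) (α : ℝ) (r m : ℕ)
    (B : ℝ → (ℝ → (Fin m → ℂ)) →ₗ[ℂ] (Fin (r * m) → ℂ)) : Prop :=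
  ∀ y : ℝ → (Fin m → ℂ), vHolMem a b (n + r) α y →
    Tendsto (fun ε => B ε y) (nhdsWithin 0 (Set.Ioi 0)) (nhds (B 0 y))

/-- Condition (0): the homogeneous problem `L(0)y = 0`, `B(0)y = 0` has only the
trivial solution in `(C^{n+r,α})^m`. -/
def Cond0 (a b : ℝ) (n : ℕ) (α : ℝ) (r m : ℕ)
    (A : Fin r → ℝ → Matrix (Fin m) (Fin m) ℂ)
    (B : (ℝ → (Fin m → ℂ)) →ₗ[ℂ] (Fin (r * m) → ℂ)) : Prop :=
  ∀ y : ℝ → (Fin m → ℂ), vHolMem a b (n + r) α y →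
    (∀ t ∈ Set.Icc a b, Lop a b r A y t = 0) → B y = 0 →
    ∀ t ∈ Set.Icc a b, y t = 0

/-- Condition (∗): for every `ε ∈ [0,ε₁)` and arbitrary data `f ∈ (C^{n,α})^m`, `c ∈ ℂ^{rm}`,
the problem `L(ε)y = f`, `B(ε)y = c` has a unique solution `y ∈ (C^{n+r,α})^m`
(uniqueness is understood as equality on `[a,b]`). -/
def CondStar (a b : ℝ) (n : ℕ) (α : ℝ) (r m : ℕ) (ε₁ : ℝ)
    (A : ℝ → Fin r → ℝ → Matrix (Fin m) (Fin m) ℂ)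
    (B : ℝ → (ℝ → (Fin m → ℂ)) →ₗ[ℂ] (Fin (r * m) → ℂ)) : Prop :=
  ∀ ε ∈ Set.Ico (0 : ℝ) ε₁, ∀ f : ℝ → (Fin m → ℂ), vHolMem a b n α f →
    ∀ c : Fin (r * m) → ℂ,
      ∃ y, IsSol a b n α r m (A ε) (B ε) f c y ∧
        ∀ y', IsSol a b n α r m (A ε) (B ε) f c y' → Set.EqOn y' y (Set.Icc a b)

/-- Condition (∗∗): if `f(·,ε) → f(·,0)` in `(C^{n,α})^m` and `c(ε) → c(0)` in `ℂ^{rm}`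
as `ε → 0+`, then the solutions satisfy `y(·,ε) → y(·,0)` in `(C^{n+r,α})^m`. -/
def CondStarStar (a b : ℝ) (n : ℕ) (α : ℝ) (r m : ℕ) (ε₁ : ℝ)
    (A : ℝ → Fin r → ℝ → Matrix (Fin m) (Fin m) ℂ)
    (B : ℝ → (ℝ → (Fin m → ℂ)) →ₗ[ℂ] (Fin (r * m) → ℂ)) : Prop :=
  ∀ (f : ℝ → ℝ → (Fin m → ℂ)) (c : ℝ → Fin (r * m) → ℂ) (y : ℝ → ℝ → (Fin m → ℂ)),
    (∀ ε ∈ Set.Ico (0 : ℝ) ε₁, vHolMem a b n α (f ε) ∧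
      IsSol a b n α r m (A ε) (B ε) (f ε) (c ε) (y ε)) →
    Tendsto (fun ε => vHolNorm a b n α (fun t => f ε t - f 0 t))
      (nhdsWithin 0 (Set.Ioi 0)) (nhds 0) →
    Tendsto c (nhdsWithin 0 (Set.Ioi 0)) (nhds (c 0)) →
    Tendsto (fun ε => vHolNorm a b (n + r) α (fun t => y ε t - y 0 t))
      (nhdsWithin 0 (Set.Ioi 0)) (nhds 0)


/-- Recursive quantitative description of Hölder functions. -/
def HB (a b α : ℝ) : ℕ → ℝ → (ℝ → ℂ) → Prop
  | 0, M, x => (∀ t ∈ Set.Icc a b, ‖x t‖ ≤ M) ∧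
      ∀ t₁ ∈ Set.Icc a b, ∀ t₂ ∈ Set.Icc a b, t₁ < t₂ → ‖x t₂ - x t₁‖ ≤ M * (t₂ - t₁) ^ α
  | (n + 1), M, x => (∀ t ∈ Set.Icc a b, ‖x t‖ ≤ M) ∧
      ∃ x' : ℝ → ℂ, (∀ t ∈ Set.Icc a b, HasDerivWithinAt x (x' t) (Set.Icc a b) t) ∧
        HB a b α n M x'

namespace HB

variable {a b α : ℝ}

theorem bound {n : ℕ} {M : ℝ} {x : ℝ → ℂ} (h : HB a b α n M x) :
    ∀ t ∈ Set.Icc a b, ‖x t‖ ≤ M := by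
  cases n with
  | zero => exact h.1
  | succ n => exact h.1

theorem nonneg (hab : a < b) {n : ℕ} {M : ℝ} {x : ℝ → ℂ} (h : HB a b α n M x) : 0 ≤ M :=
  (norm_nonneg _).trans (h.bound a ⟨le_rfl, hab.le⟩)

theorem mono {n : ℕ} {M M' : ℝ} {x : ℝ → ℂ} (h : HB a b α n M x) (hM : M ≤ M') :
    HB a b α n M' x := by
  induction n generalizing x with
  | zero =>
    refine ⟨fun t ht => (h.1 t ht).trans hM, fun t₁ h1 t₂ h2 hl => (h.2 t₁ h1 t₂ h2 hl).trans ?_⟩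
    have : 0 ≤ (t₂ - t₁) ^ α := Real.rpow_nonneg (by linarith) _
    gcongr
  | succ n ih =>
    obtain ⟨h1, x', h2, h3⟩ := h
    exact ⟨fun t ht => (h1 t ht).trans hM, x', h2, ih h3⟩

theorem congr {n : ℕ} {M : ℝ} {x y : ℝ → ℂ} (h : HB a b α n M x)
    (hxy : ∀ t ∈ Set.Icc a b, y t = x t) : HB a b α n M y := by
  cases n with
  | zero =>
    refine ⟨fun t ht => by rw [hxy t ht]; exact h.1 t ht, fun t₁ h1 t₂ h2 hl => ?_⟩
    rw [hxy _ h1, hxy _ h2]; exact h.2 t₁ h1 t₂ h2 hl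
  | succ n =>
    obtain ⟨h1, x', h2, h3⟩ := h
    refine ⟨fun t ht => by rw [hxy t ht]; exact h1 t ht, x', fun t ht => ?_, h3⟩
    exact (h2 t ht).congr hxy (hxy t ht)

theorem add {n : ℕ} {M M' : ℝ} {x y : ℝ → ℂ} (h : HB a b α n M x) (h' : HB a b α n M' y) :
    HB a b α n (M + M') (fun t => x t + y t) := by
  induction n generalizing x y with
  | zero =>
    refine ⟨fun t ht => (norm_add_le _ _).trans (add_le_add (h.1 t ht) (h'.1 t ht)),
      fun t₁ h1 t₂ h2 hl => ?_⟩
    have e : x t₂ + y t₂ - (x t₁ + y t₁) = (x t₂ - x t₁) + (y t₂ - y t₁) := by ring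
    rw [e, add_mul]
    exact (norm_add_le _ _).trans (add_le_add (h.2 t₁ h1 t₂ h2 hl) (h'.2 t₁ h1 t₂ h2 hl))
  | succ n ih =>
    obtain ⟨h1, x', h2, h3⟩ := h
    obtain ⟨h1', y', h2', h3'⟩ := h'
    exact ⟨fun t ht => (norm_add_le _ _).trans (add_le_add (h1 t ht) (h1' t ht)), _,
      fun t ht => (h2 t ht).add (h2' t ht), ih h3 h3'⟩

theorem zero {n : ℕ} : HB a b α n 0 (fun _ => 0) := by
  induction n with
  | zero => exact ⟨fun t ht => by simp, fun t₁ h1 t₂ h2 hl => by simp⟩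
  | succ n ih =>
    exact ⟨fun t ht => by simp, _, fun t ht => hasDerivWithinAt_const _ _ _, ih⟩

theorem smul {n : ℕ} {M : ℝ} {x : ℝ → ℂ} (h : HB a b α n M x) (c : ℂ) :
    HB a b α n (‖c‖ * M) (fun t => c * x t) := by
  induction n generalizing x with
  | zero =>
    refine ⟨fun t ht => ?_, fun t₁ h1 t₂ h2 hl => ?_⟩
    · rw [norm_mul]; exact mul_le_mul_of_nonneg_left (h.1 t ht) (norm_nonneg _)
    · rw [← mul_sub, norm_mul, mul_assoc]
      exact mul_le_mul_of_nonneg_left (h.2 t₁ h1 t₂ h2 hl) (norm_nonneg _)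
  | succ n ih =>
    obtain ⟨h1, x', h2, h3⟩ := h
    refine ⟨fun t ht => ?_, _, fun t ht => (h2 t ht).const_mul c, ih h3⟩
    rw [norm_mul]; exact mul_le_mul_of_nonneg_left (h1 t ht) (norm_nonneg _)

theorem neg {n : ℕ} {M : ℝ} {x : ℝ → ℂ} (h : HB a b α n M x) :
    HB a b α n M (fun t => - x t) := by
  have := h.smul (-1)
  simpa using this

theorem sub {n : ℕ} {M M' : ℝ} {x y : ℝ → ℂ} (h : HB a b α n M x) (h' : HB a b α n M' y) :
    HB a b α n (M + M') (fun t => x t - y t) := by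
  simpa [sub_eq_add_neg] using h.add h'.neg

theorem sum {ι : Type*} {n : ℕ} (s : Finset ι) {M : ι → ℝ} {x : ι → ℝ → ℂ}
    (h : ∀ i ∈ s, HB a b α n (M i) (x i)) :
    HB a b α n (∑ i ∈ s, M i) (fun t => ∑ i ∈ s, x i t) := by
  classical
  induction s using Finset.induction_on with
  | empty => simpa using zero
  | insert i s hi ih =>
    simp only [Finset.sum_insert hi]
    exact (h i (by simp)).add (ih fun j hj => h j (by simp [hj]))

/-- A derivative bound yields a Hölder bound. -/
theorem holder_of_deriv (hα1 : α ≤ 1) {M : ℝ} {x x' : ℝ → ℂ}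
    (hx : ∀ t ∈ Set.Icc a b, HasDerivWithinAt x (x' t) (Set.Icc a b) t)
    (hM : ∀ t ∈ Set.Icc a b, ‖x' t‖ ≤ M) :
    ∀ t₁ ∈ Set.Icc a b, ∀ t₂ ∈ Set.Icc a b, t₁ < t₂ →
      ‖x t₂ - x t₁‖ ≤ ((b - a) ^ (1 - α) * M) * (t₂ - t₁) ^ α := by
  intro t₁ h1 t₂ h2 hl
  have h := (convex_Icc a b).norm_image_sub_le_of_norm_hasDerivWithin_le hx hM h1 h2
  have hM0 : 0 ≤ M := (norm_nonneg _).trans (hM t₁ h1)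
  have hp : 0 < t₂ - t₁ := by linarith
  have e : t₂ - t₁ = (t₂ - t₁) ^ (1 - α) * (t₂ - t₁) ^ α := by
    rw [← Real.rpow_add hp]; simp
  have hle : (t₂ - t₁) ^ (1 - α) ≤ (b - a) ^ (1 - α) :=
    Real.rpow_le_rpow hp.le (by linarith [h1.1, h2.2]) (by linarith)
  rw [Real.norm_of_nonneg hp.le] at h
  have h0 : 0 ≤ (t₂ - t₁) ^ α := Real.rpow_nonneg hp.le _
  calc _ ≤ M * (t₂ - t₁) := h
    _ = ((t₂ - t₁) ^ (1 - α) * M) * (t₂ - t₁) ^ α := by conv_lhs => rw [e]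
                                                        ring
    _ ≤ _ := by gcongr

/-- embedding constant -/
def emb (a b α : ℝ) : ℝ := max 1 ((b - a) ^ (1 - α))

theorem one_le_emb : 1 ≤ emb a b α := le_max_left _ _

theorem down (hab : a < b) (hα1 : α ≤ 1) {n : ℕ} {M : ℝ} {x : ℝ → ℂ}
    (h : HB a b α (n + 1) M x) : HB a b α n (emb a b α * M) x := by
  have hM := h.nonneg hab
  have hM1 : M ≤ emb a b α * M := le_mul_of_one_le_left hM one_le_emb
  induction n generalizing x with
  | zero =>
    obtain ⟨h1, x', h2, h3⟩ := h
    refine ⟨fun t ht => (h1 t ht).trans hM1, fun t₁ g1 t₂ g2 hl =>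
      (holder_of_deriv hα1 h2 h3.bound t₁ g1 t₂ g2 hl).trans ?_⟩
    have : 0 ≤ (t₂ - t₁) ^ α := Real.rpow_nonneg (by linarith) _
    gcongr
    exact le_max_right _ _
  | succ n ih =>
    obtain ⟨h1, x', h2, h3⟩ := h
    exact ⟨fun t ht => (h1 t ht).trans hM1, x', h2, ih h3⟩

theorem down_add (hab : a < b) (hα1 : α ≤ 1) {n : ℕ} (k : ℕ) {M : ℝ} {x : ℝ → ℂ}
    (h : HB a b α (n + k) M x) : HB a b α n (emb a b α ^ k * M) x := by
  induction k generalizing M with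
  | zero => simpa using h
  | succ k ih =>
    have := ih (down hab hα1 (n := n + k) h)
    rwa [← mul_assoc, ← pow_succ] at this

theorem mul_exists (hab : a < b) (hα1 : α ≤ 1) (n : ℕ) : ∃ C : ℝ, 0 ≤ C ∧
    ∀ (M M' : ℝ) (x y : ℝ → ℂ), HB a b α n M x → HB a b α n M' y →
      HB a b α n (C * (M * M')) (fun t => x t * y t) := by
  induction n with
  | zero =>
    refine ⟨2, by norm_num, fun M M' x y h h' => ?_⟩
    have hM := h.nonneg hab
    have hM' := h'.nonneg hab
    refine ⟨fun t ht => ?_, fun t₁ h1 t₂ h2 hl => ?_⟩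
    · rw [norm_mul]
      have := mul_le_mul (h.1 t ht) (h'.1 t ht) (norm_nonneg _) hM
      nlinarith [mul_nonneg hM hM']
    · have e : x t₂ * y t₂ - x t₁ * y t₁ = x t₂ * (y t₂ - y t₁) + (x t₂ - x t₁) * y t₁ := by ring
      have h0 : 0 ≤ (t₂ - t₁) ^ α := Real.rpow_nonneg (by linarith) _
      rw [e]
      refine (norm_add_le _ _).trans ?_
      rw [norm_mul, norm_mul]
      have k1 := mul_le_mul (h.1 t₂ h2) (h'.2 t₁ h1 t₂ h2 hl) (norm_nonneg _) hM
      have k2 := mul_le_mul (h.2 t₁ h1 t₂ h2 hl) (h'.1 t₁ h1) (norm_nonneg _) (by positivity)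
      nlinarith
  | succ n ih =>
    obtain ⟨C, hC, ih⟩ := ih
    have hE : 1 ≤ emb a b α := one_le_emb
    refine ⟨max 1 (2 * C * emb a b α), by positivity, fun M M' x y h h' => ?_⟩
    have hM := h.nonneg hab
    have hM' := h'.nonneg hab
    have hd := h.down hab hα1
    have hd' := h'.down hab hα1
    obtain ⟨h1, x', h2, h3⟩ := h
    obtain ⟨h1', y', h2', h3'⟩ := h'
    refine ⟨fun t ht => ?_, _, fun t ht => (h2 t ht).mul (h2' t ht), ?_⟩
    · rw [norm_mul]
      refine (mul_le_mul (h1 t ht) (h1' t ht) (norm_nonneg _) hM).trans ?_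
      exact le_mul_of_one_le_left (by positivity) (le_max_left _ _)
    · refine ((ih _ _ _ _ h3 hd').add (ih _ _ _ _ hd h3')).mono ?_
      calc _ = (2 * C * emb a b α) * (M * M') := by ring
        _ ≤ _ := by gcongr; exact le_max_right _ _

theorem derivWithin_of (hab : a < b) {n : ℕ} {M : ℝ} {x : ℝ → ℂ} (h : HB a b α (n + 1) M x) :
    HB a b α n M (derivWithin x (Set.Icc a b)) := by
  obtain ⟨_, x', h2, h3⟩ := h
  exact h3.congr fun t ht => (h2 t ht).derivWithin (uniqueDiffOn_Icc hab t ht)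

theorem iter (hab : a < b) {n : ℕ} (j : ℕ) {M : ℝ} {x : ℝ → ℂ} (h : HB a b α (n + j) M x) :
    HB a b α n M (iteratedDerivWithin j x (Set.Icc a b)) := by
  induction j generalizing x with
  | zero => exact h.congr fun t ht => by simp
  | succ j ih =>
    exact (ih (derivWithin_of hab h)).congr fun t ht => by rw [iteratedDerivWithin_succ']

theorem iter_le (hab : a < b) (hα1 : α ≤ 1) {n r j : ℕ} (hj : j ≤ r) {M : ℝ} {x : ℝ → ℂ}
    (h : HB a b α (n + r) M x) :
    HB a b α n (emb a b α ^ r * M) (iteratedDerivWithin j x (Set.Icc a b)) := by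
  have hM := h.nonneg hab
  obtain ⟨k, rfl⟩ := Nat.exists_eq_add_of_le hj
  have h1 : HB a b α (n + k + j) M x := by
    have e : n + k + j = n + (j + k) := by omega
    rwa [e]
  refine (down_add hab hα1 k (iter hab j h1)).mono ?_
  gcongr
  · exact one_le_emb
  · omega

theorem of_contDiffOn (hab : a < b) (hα1 : α ≤ 1) {n : ℕ} {x : ℝ → ℂ}
    (h : ContDiffOn ℝ (n + 1 : ℕ) x (Set.Icc a b)) : ∃ M, HB a b α n M x := by
  have hu := uniqueDiffOn_Icc hab
  induction n generalizing x with
  | zero =>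
    obtain ⟨M, hM⟩ := isCompact_Icc.exists_bound_of_continuousOn h.continuousOn
    have hd := (contDiffOn_succ_iff_derivWithin (n := ((0 : ℕ) : WithTop ℕ∞)) hu).1
      (by simpa using h)
    obtain ⟨M', hM'⟩ := isCompact_Icc.exists_bound_of_continuousOn hd.2.2.continuousOn
    refine ⟨max M ((b - a) ^ (1 - α) * M'), fun t ht => (hM t ht).trans (le_max_left _ _), ?_⟩
    intro t₁ h1 t₂ h2 hl
    refine (holder_of_deriv hα1 (fun t ht => (hd.1 t ht).hasDerivWithinAt) hM' t₁ h1 t₂ h2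
      hl).trans ?_
    have : 0 ≤ (t₂ - t₁) ^ α := Real.rpow_nonneg (by linarith) _
    gcongr
    exact le_max_right _ _
  | succ n ih =>
    obtain ⟨M, hM⟩ := isCompact_Icc.exists_bound_of_continuousOn h.continuousOn
    have hd := (contDiffOn_succ_iff_derivWithin (n := ((n + 1 : ℕ) : WithTop ℕ∞)) hu).1
      (by simpa using h)
    obtain ⟨M', hM'⟩ := ih hd.2.2
    exact ⟨max M M', fun t ht => (hM t ht).trans (le_max_left _ _), _,
      fun t ht => (hd.1 t ht).hasDerivWithinAt, hM'.mono (le_max_right _ _)⟩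

theorem of_explicit (hab : a < b) {n : ℕ} {M : ℝ} {x : ℝ → ℂ}
    (h : ContDiffOn ℝ n x (Set.Icc a b))
    (h1 : ∀ j ≤ n, ∀ t ∈ Set.Icc a b, ‖iteratedDerivWithin j x (Set.Icc a b) t‖ ≤ M)
    (h2 : ∀ t₁ ∈ Set.Icc a b, ∀ t₂ ∈ Set.Icc a b, t₁ < t₂ →
      ‖iteratedDerivWithin n x (Set.Icc a b) t₂ - iteratedDerivWithin n x (Set.Icc a b) t₁‖ ≤
        M * (t₂ - t₁) ^ α) : HB a b α n M x := by
  have hu := uniqueDiffOn_Icc hab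
  induction n generalizing x with
  | zero => 
    simp only [iteratedDerivWithin_zero] at h2
    exact ⟨fun t ht => by simpa using h1 0 le_rfl t ht, h2⟩
  | succ n ih =>
    have hd := (contDiffOn_succ_iff_derivWithin (n := (n : WithTop ℕ∞)) hu).1
      (by simpa using h)
    refine ⟨fun t ht => by simpa using h1 0 (by omega) t ht, _,
      fun t ht => (hd.1 t ht).hasDerivWithinAt, ih hd.2.2 ?_ ?_⟩
    · intro j hj t ht
      rw [← iteratedDerivWithin_succ']; exact h1 _ (by omega) t ht
    · simpa only [iteratedDerivWithin_succ'] using h2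

theorem contDiffOn (hab : a < b) (hα0 : 0 < α) {n : ℕ} {M : ℝ} {x : ℝ → ℂ}
    (h : HB a b α n M x) : ContDiffOn ℝ n x (Set.Icc a b) := by
  have hu := uniqueDiffOn_Icc hab
  induction n generalizing x with
  | zero =>
    have hM := h.nonneg hab
    simp only [Nat.cast_zero, contDiffOn_zero]
    have hH : HolderOnWith ⟨M, hM⟩ ⟨α, hα0.le⟩ x (Set.Icc a b) := by
      have key : ∀ s ∈ Set.Icc a b, ∀ t ∈ Set.Icc a b, dist (x s) (x t) ≤ M * dist s t ^ α := by
        intro s hs t ht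
        rcases lt_trichotomy s t with hst | rfl | hst
        · rw [dist_comm, dist_comm s, dist_eq_norm, Real.dist_eq, abs_of_pos (by linarith)]
          exact h.2 s hs t ht hst
        · simp [hα0.ne']
        · rw [dist_eq_norm, Real.dist_eq, abs_of_pos (by linarith)]
          exact h.2 t ht s hs hst
      intro s hs t ht
      rw [edist_dist, edist_dist]
      have := ENNReal.ofReal_le_ofReal (key s hs t ht)
      rw [ENNReal.ofReal_mul hM, ← ENNReal.ofReal_rpow_of_nonneg dist_nonneg hα0.le] at this
      convert this using 2
      · exact (ENNReal.ofReal_eq_coe_nnreal hM).symm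
      · rfl
    exact hH.continuousOn (by exact hα0)
  | succ n ih =>
    have hd := ih (derivWithin_of hab h)
    obtain ⟨h1, x', h2, h3⟩ := h
    have := (contDiffOn_succ_iff_derivWithin (n := (n : WithTop ℕ∞)) hu).2
      ⟨fun t ht => (h2 t ht).differentiableWithinAt, by simp, hd⟩
    simpa using this

theorem top_holder {M : ℝ} {n : ℕ} (hab : a < b) {x : ℝ → ℂ} (h : HB a b α n M x) :
    ∀ t₁ ∈ Set.Icc a b, ∀ t₂ ∈ Set.Icc a b, t₁ < t₂ →
      ‖iteratedDerivWithin n x (Set.Icc a b) t₂ - iteratedDerivWithin n x (Set.Icc a b) t₁‖ ≤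
        M * (t₂ - t₁) ^ α :=
  (iter (n := 0) hab n (by simpa using h)).2

theorem iter_bound {M : ℝ} {n j : ℕ} (hab : a < b) (hj : j ≤ n) {x : ℝ → ℂ}
    (h : HB a b α n M x) :
    ∀ t ∈ Set.Icc a b, ‖iteratedDerivWithin j x (Set.Icc a b) t‖ ≤ M := by
  obtain ⟨k, rfl⟩ := Nat.exists_eq_add_of_le' hj
  exact (iter hab j h).bound

theorem holMem (hab : a < b) (hα0 : 0 < α) {n : ℕ} {M : ℝ} {x : ℝ → ℂ}
    (h : HB a b α n M x) : HolMem a b n α x :=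
  ⟨h.contDiffOn hab hα0, M, h.top_holder hab⟩

theorem holNorm_le (hab : a < b) {n : ℕ} {M : ℝ} {x : ℝ → ℂ}
    (h : HB a b α n M x) : holNorm a b n α x ≤ (n + 2) * M := by
  have hM := h.nonneg hab
  have e : ((n : ℝ) + 2) * M = (∑ j ∈ Finset.range (n + 1), M) + M := by
    simp; ring
  rw [e]
  unfold holNorm holSemiNorm
  refine add_le_add (Finset.sum_le_sum fun j hj => Real.sSup_le ?_ hM) (Real.sSup_le ?_ hM)
  · rintro s ⟨t, ht, rfl⟩
    exact h.iter_bound hab (by simpa [Nat.lt_succ_iff] using hj) t ht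
  · rintro s ⟨t₁, h1, t₂, h2, hl, rfl⟩
    rw [div_le_iff₀ (Real.rpow_pos_of_pos (by linarith) _)]
    exact h.top_holder hab t₁ h1 t₂ h2 hl

end HB

theorem holNorm_nonneg (a b : ℝ) (n : ℕ) (α : ℝ) (x : ℝ → ℂ) : 0 ≤ holNorm a b n α x := by
  unfold holNorm holSemiNorm
  refine add_nonneg (Finset.sum_nonneg fun j _ => Real.sSup_nonneg ?_) (Real.sSup_nonneg ?_)
  · rintro s ⟨t, ht, rfl⟩; positivity
  · rintro s ⟨t₁, h1, t₂, h2, hl, rfl⟩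
    exact div_nonneg (norm_nonneg _) (Real.rpow_nonneg (by linarith) _)

theorem HolMem.hb {a b α : ℝ} (hab : a < b) {n : ℕ} {x : ℝ → ℂ} (h : HolMem a b n α x) :
    HB a b α n (holNorm a b n α x) x := by
  have hs : 0 ≤ holSemiNorm a b n α x := by
    refine Real.sSup_nonneg ?_
    rintro s ⟨t₁, h1, t₂, h2, hl, rfl⟩
    exact div_nonneg (norm_nonneg _) (Real.rpow_nonneg (by linarith) _)
  have hj0 : ∀ j, 0 ≤ sSup { s : ℝ | ∃ t ∈ Set.Icc a b,
      s = ‖iteratedDerivWithin j x (Set.Icc a b) t‖ } := by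
    intro j
    refine Real.sSup_nonneg ?_
    rintro s ⟨t, ht, rfl⟩; positivity
  obtain ⟨hc, C, hC⟩ := h
  refine HB.of_explicit hab hc ?_ ?_
  · intro j hj t ht
    have hcj := hc.continuousOn_iteratedDerivWithin (m := j) (by exact_mod_cast hj)
      (uniqueDiffOn_Icc hab)
    obtain ⟨M, hM⟩ := isCompact_Icc.exists_bound_of_continuousOn hcj
    have h1 : ‖iteratedDerivWithin j x (Set.Icc a b) t‖ ≤ sSup { s : ℝ | ∃ t ∈ Set.Icc a b,
        s = ‖iteratedDerivWithin j x (Set.Icc a b) t‖ } := by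
      refine le_csSup ⟨M, ?_⟩ ⟨t, ht, rfl⟩
      rintro s ⟨u, hu, rfl⟩; exact hM u hu
    have h2 := Finset.single_le_sum (f := fun j => sSup { s : ℝ | ∃ t ∈ Set.Icc a b,
        s = ‖iteratedDerivWithin j x (Set.Icc a b) t‖ }) (fun i _ => hj0 i)
        (Finset.mem_range.2 (Nat.lt_succ_of_le hj))
    unfold holNorm
    linarith
  · intro t₁ h1 t₂ h2 hl
    have hp := Real.rpow_pos_of_pos (sub_pos.2 hl) α
    rw [← div_le_iff₀ hp]
    have h3 : ‖iteratedDerivWithin n x (Set.Icc a b) t₂ -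
        iteratedDerivWithin n x (Set.Icc a b) t₁‖ / (t₂ - t₁) ^ α ≤ holSemiNorm a b n α x := by
      refine le_csSup ⟨C, ?_⟩ ⟨t₁, h1, t₂, h2, hl, rfl⟩
      rintro s ⟨u₁, g1, u₂, g2, gl, rfl⟩
      rw [div_le_iff₀ (Real.rpow_pos_of_pos (by linarith) _)]
      exact hC _ g1 _ g2 gl
    have := Finset.sum_nonneg (s := Finset.range (n + 1)) (fun j _ => hj0 j)
    unfold holNorm
    linarith

theorem vHolNorm_nonneg (a b : ℝ) (n : ℕ) (α : ℝ) {k : ℕ} (x : ℝ → (Fin k → ℂ)) :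
    0 ≤ vHolNorm a b n α x := Finset.sum_nonneg fun _ _ => holNorm_nonneg _ _ _ _ _

theorem vHolMem.hb {a b α : ℝ} (hab : a < b) {n k : ℕ} {x : ℝ → (Fin k → ℂ)}
    (h : vHolMem a b n α x) (i : Fin k) :
    HB a b α n (vHolNorm a b n α x) (fun t => x t i) :=
  ((h i).hb hab).mono (Finset.single_le_sum (f := fun i => holNorm a b n α (fun t => x t i))
    (fun _ _ => holNorm_nonneg _ _ _ _ _) (Finset.mem_univ i))

theorem vHolNorm_le {a b α : ℝ} (hab : a < b) {n k : ℕ} {M : ℝ} {x : ℝ → (Fin k → ℂ)}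
    (h : ∀ i, HB a b α n M (fun t => x t i)) : vHolNorm a b n α x ≤ k * ((n + 2) * M) := by
  unfold vHolNorm
  refine (Finset.sum_le_sum fun i _ => (h i).holNorm_le hab).trans ?_
  simp

theorem zero_of_deriv_le {E : Type*} [NormedAddCommGroup E] [NormedSpace ℝ E] {a b K t₀ : ℝ}
    {f f' : ℝ → E} (hf : ∀ t ∈ Set.Icc a b, HasDerivWithinAt f (f' t) (Set.Icc a b) t)
    (hK : ∀ t ∈ Set.Icc a b, ‖f' t‖ ≤ K * ‖f t‖) (ht₀ : t₀ ∈ Set.Icc a b) (h0 : f t₀ = 0) :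
    ∀ t ∈ Set.Icc a b, f t = 0 := by
  have hc : ContinuousOn f (Set.Icc a b) := fun t ht => (hf t ht).continuousWithinAt
  intro t ht
  rcases le_total t₀ t with hl | hl
  · have hsub : Set.Icc t₀ t ⊆ Set.Icc a b := Set.Icc_subset_Icc ht₀.1 ht.2
    have := norm_le_gronwallBound_of_norm_deriv_right_le (f := f) (f' := f') (δ := 0) (K := K)
      (ε := 0) (a := t₀) (b := t) (hc.mono hsub) (fun x hx => ?_) (by simp [h0])
      (fun x hx => by simpa using hK x (hsub ⟨hx.1, hx.2.le⟩)) t ⟨hl, le_rfl⟩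
    · rw [gronwallBound_ε0_δ0] at this
      simpa using this
    · have h1 := hf x (hsub ⟨hx.1, hx.2.le⟩)
      refine h1.mono_of_mem_nhdsWithin ?_
      refine Filter.mem_of_superset (Icc_mem_nhdsGE (hx.2.trans_le ht.2)) ?_
      exact Set.Icc_subset_Icc (ht₀.1.trans hx.1) le_rfl
  · have hsub : Set.Icc t t₀ ⊆ Set.Icc a b := Set.Icc_subset_Icc ht.1 ht₀.2
    have hneg : ∀ x, x ∈ Set.Icc (-t₀) (-t) → -x ∈ Set.Icc t t₀ := fun x hx =>
      ⟨by linarith [hx.2], by linarith [hx.1]⟩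
    have := norm_le_gronwallBound_of_norm_deriv_right_le (f := fun s => f (-s))
      (f' := fun s => -f' (-s)) (δ := 0) (K := K)
      (ε := 0) (a := -t₀) (b := -t)
      (hc.comp continuous_neg.continuousOn (fun x hx => hsub (hneg x hx)))
      (fun x hx => ?_) (by simp [h0])
      (fun x hx => by simpa using hK (-x) (hsub (hneg x ⟨hx.1, hx.2.le⟩))) (-t)
      ⟨by linarith, le_rfl⟩
    · rw [gronwallBound_ε0_δ0] at this
      simpa using this
    · have h1 := hf (-x) (hsub (hneg x ⟨hx.1, hx.2.le⟩))
      have h2 : HasDerivWithinAt f (f' (-x)) (Set.Iic (-x)) (-x) := by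
        refine h1.mono_of_mem_nhdsWithin ?_
        refine Filter.mem_of_superset (Icc_mem_nhdsLE (a := a) (by linarith [hx.2, ht.1])) ?_
        exact Set.Icc_subset_Icc le_rfl (by linarith [hx.1, ht₀.2])
      have h3 : HasDerivWithinAt (fun s : ℝ => -s) (-1) (Set.Ici x) x :=
        (hasDerivAt_neg x).hasDerivWithinAt
      have := HasDerivWithinAt.scomp x h2 h3 (fun s hs => by simpa using hs)
      simpa [Function.comp_def] using this

theorem zero_of_cauchy {a b α : ℝ} (hab : a < b) {n r m : ℕ} (hr : 2 ≤ r)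
    {A : Fin r → ℝ → Matrix (Fin m) (Fin m) ℂ} {MA : ℝ}
    (hA : ∀ j i l, ∀ t ∈ Set.Icc a b, ‖A j t i l‖ ≤ MA) {y : ℝ → (Fin m → ℂ)}
    (hy : vHolMem a b (n + r) α y) (hL : ∀ t ∈ Set.Icc a b, Lop a b r A y t = 0)
    {t₀ : ℝ} (ht₀ : t₀ ∈ Set.Icc a b)
    (h0 : ∀ (j : Fin r) i, iteratedDerivWithin j (fun s => y s i) (Set.Icc a b) t₀ = 0) :
    ∀ t ∈ Set.Icc a b, y t = 0 := by
  have hu := uniqueDiffOn_Icc hab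
  let u : ℝ → Fin r → Fin m → ℂ := fun t j i =>
    iteratedDerivWithin j (fun s => y s i) (Set.Icc a b) t
  let u' : ℝ → Fin r → Fin m → ℂ := fun t j i =>
    iteratedDerivWithin (j + 1) (fun s => y s i) (Set.Icc a b) t
  have hd : ∀ t ∈ Set.Icc a b, HasDerivWithinAt u (u' t) (Set.Icc a b) t := by
    intro t ht
    rw [hasDerivWithinAt_pi]; intro j
    rw [hasDerivWithinAt_pi]; intro i
    have := (hy i).1.differentiableOn_iteratedDerivWithin (m := j)
      (by exact_mod_cast (by omega : (j : ℕ) < n + r)) hu t ht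
    have h2 := this.hasDerivWithinAt
    rw [← iteratedDerivWithin_succ] at h2
    exact h2
  have hb : ∀ t ∈ Set.Icc a b, ‖u' t‖ ≤ (1 + r * (m * |MA|)) * ‖u t‖ := by
    intro t ht
    have hp : 0 ≤ (r : ℝ) * (m * |MA|) := by positivity
    have hcomp : ∀ j i, ‖u t j i‖ ≤ ‖u t‖ := fun j i =>
      (norm_le_pi_norm (u t j) i).trans (norm_le_pi_norm (u t) j)
    refine (pi_norm_le_iff_of_nonneg (by positivity)).2 fun j =>
      (pi_norm_le_iff_of_nonneg (by positivity)).2 fun i => ?_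
    by_cases hj : (j : ℕ) + 1 < r
    · refine (hcomp ⟨j + 1, hj⟩ i).trans ?_
      exact le_mul_of_one_le_left (norm_nonneg _) (by linarith)
    · have hjr : (j : ℕ) + 1 = r := by omega
      have h1 := congrFun (hL t ht) i
      simp only [Lop, vDeriv, Pi.add_apply, Finset.sum_apply, Matrix.mulVec, dotProduct,
        Pi.zero_apply] at h1
      have h2 : u' t j i = - ∑ j : Fin r, ∑ l, A j t i l * u t j l := by
        have : u' t j i = iteratedDerivWithin r (fun s => y s i) (Set.Icc a b) t := by
          simp only [u', hjr]
        rw [this]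
        exact eq_neg_of_add_eq_zero_left h1
      rw [h2, norm_neg]
      have h3 : ‖∑ j : Fin r, ∑ l, A j t i l * u t j l‖ ≤
          ∑ j : Fin r, ∑ l : Fin m, |MA| * ‖u t‖ := by
        refine (norm_sum_le _ _).trans (Finset.sum_le_sum fun j _ => ?_)
        refine (norm_sum_le _ _).trans (Finset.sum_le_sum fun l _ => ?_)
        rw [norm_mul]
        exact mul_le_mul ((hA j i l t ht).trans (le_abs_self _)) (hcomp j l) (norm_nonneg _)
          (abs_nonneg _)
      refine h3.trans ?_
      simp only [Finset.sum_const, Finset.card_univ, Fintype.card_fin, nsmul_eq_mul]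
      nlinarith [norm_nonneg (u t)]
  have hz := zero_of_deriv_le hd hb ht₀ (by ext j i; exact h0 j i)
  intro t ht
  ext i
  have := congrFun (congrFun (hz t ht) ⟨0, by omega⟩) i
  simpa [u] using this

theorem contDiffOn_det {κ : Type*} [Fintype κ] [DecidableEq κ] {s : Set ℝ} {N : ℕ}
    {W : ℝ → Matrix κ κ ℂ} (hW : ∀ i j, ContDiffOn ℝ N (fun t => W t i j) s) :
    ContDiffOn ℝ N (fun t => (W t).det) s := by
  simp only [Matrix.det_apply']
  refine ContDiffOn.sum fun σ _ => ?_
  refine contDiffOn_const.mul ?_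
  exact contDiffOn_prod fun i _ => hW _ _

theorem exists_inverse {ι κ : Type*} [Fintype ι] [Fintype κ] [DecidableEq ι] [DecidableEq κ]
    (hcard : Fintype.card ι = Fintype.card κ) {s : Set ℝ} {N : ℕ} {W : ℝ → Matrix ι κ ℂ}
    (hW : ∀ i j, ContDiffOn ℝ N (fun t => W t i j) s)
    (hinj : ∀ t ∈ s, ∀ v, (W t).mulVec v = 0 → v = 0) :
    ∃ Q : ℝ → Matrix κ ι ℂ, (∀ i j, ContDiffOn ℝ N (fun t => Q t i j) s) ∧
      ∀ t ∈ s, W t * Q t = 1 := by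
  let e : κ ≃ ι := (Fintype.equivOfCardEq hcard).symm
  let V : ℝ → Matrix κ κ ℂ := fun t => (W t).submatrix e id
  have hV : ∀ i j, ContDiffOn ℝ N (fun t => V t i j) s := fun i j => hW _ _
  have hdet : ∀ t ∈ s, (V t).det ≠ 0 := by
    intro t ht h
    obtain ⟨v, hv, hv0⟩ := Matrix.exists_mulVec_eq_zero_iff.2 h
    refine hv (hinj t ht v ?_)
    ext i
    have := congrFun hv0 (e.symm i)
    simpa [V, Matrix.mulVec, dotProduct] using this
  refine ⟨fun t => ((V t).det⁻¹ • (V t).adjugate).submatrix id e.symm, ?_, ?_⟩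
  · intro i j
    simp only [Matrix.submatrix_apply, Matrix.smul_apply, smul_eq_mul, Matrix.adjugate_apply]
    refine ContDiffOn.mul ((contDiffOn_det hV).inv hdet) (contDiffOn_det fun p q => ?_)
    by_cases hp : p = e.symm j
    · subst hp
      simp only [Matrix.updateRow_self]
      exact contDiffOn_const
    · simp only [Matrix.updateRow_ne hp]
      exact hV _ _
  · intro t ht
    have h1 : V t * ((V t).det⁻¹ • (V t).adjugate) = 1 := by
      rw [Matrix.mul_smul, Matrix.mul_adjugate, smul_smul, inv_mul_cancel₀ (hdet t ht), one_smul]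
    have h2 : W t = (V t).submatrix e.symm id := by ext; simp [V]
    ext i j
    have := congrFun (congrFun h1 (e.symm i)) (e.symm j)
    rw [h2]
    simp only [Matrix.mul_apply, Matrix.submatrix_apply, id] at this ⊢
    rw [this]
    simp [Matrix.one_apply]

theorem exists_index {P : ℕ → ℝ → Prop} (h : ∀ k : ℕ, ∀ δ > 0, ∃ ε ∈ Set.Ioo (0 : ℝ) δ, P k ε) :
    ∃ s : ℝ → ℕ, Tendsto s (𝓝[>] 0) atTop ∧ ∃ᶠ ε in 𝓝[>] (0 : ℝ), P (s ε) ε := by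
  classical
  choose e he hP using fun k : ℕ => h k (1 / (k + 1)) (by positivity)
  let s : ℝ → ℕ := fun ε => if hk : ∃ k, e k = ε then hk.choose else ⌈1 / ε⌉₊
  refine ⟨s, ?_, ?_⟩
  · rw [tendsto_atTop]
    intro K
    have h1 : ∀ᶠ ε in 𝓝[>] (0 : ℝ), ∀ k ∈ Finset.range K, ε < e k := by
      rw [Filter.eventually_all_finset]
      intro k _
      exact (eventually_lt_nhds (he k).1).filter_mono nhdsWithin_le_nhds
    have h2 : ∀ᶠ ε in 𝓝[>] (0 : ℝ), ε < 1 / ((K : ℝ) + 1) :=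
      (eventually_lt_nhds (show (0 : ℝ) < 1 / (K + 1) by positivity)).filter_mono nhdsWithin_le_nhds
    filter_upwards [h1, h2, self_mem_nhdsWithin] with ε h1 h2 h3
    simp only [s]
    split_ifs with hk
    · by_contra hlt
      have := h1 _ (Finset.mem_range.2 (not_le.1 hlt))
      rw [hk.choose_spec] at this
      exact lt_irrefl _ this
    · have h3' : (0 : ℝ) < ε := h3
      have : (K : ℝ) ≤ 1 / ε := by
        rw [le_div_iff₀ h3']
        rw [lt_div_iff₀ (by positivity)] at h2
        nlinarith
      exact_mod_cast this.trans (Nat.le_ceil _)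
  · rw [Filter.frequently_iff]
    intro U hU
    obtain ⟨δ, hδ, hsub⟩ := mem_nhdsGT_iff_exists_Ioo_subset.1 hU
    obtain ⟨k, hk⟩ := exists_nat_one_div_lt (show (0 : ℝ) < δ from hδ)
    refine ⟨e k, hsub ⟨(he k).1, (he k).2.trans hk⟩, ?_⟩
    have hex : ∃ k', e k' = e k := ⟨k, rfl⟩
    have hs : s (e k) = hex.choose := by simp only [s]; rw [dif_pos hex]
    rw [hs]
    have := hP hex.choose
    rwa [hex.choose_spec] at this

theorem vDeriv_lincomb {a b : ℝ} (hab : a < b) {p m : ℕ} {κ : Type*} [Fintype κ]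
    {x : ℝ → (Fin m → ℂ)} {y : κ → ℝ → (Fin m → ℂ)} (c : κ → ℂ)
    (hx : ∀ i, ContDiffOn ℝ p (fun t => x t i) (Set.Icc a b))
    (hy : ∀ k i, ContDiffOn ℝ p (fun t => y k t i) (Set.Icc a b)) :
    ∀ t ∈ Set.Icc a b, vDeriv a b p (x + ∑ k, c k • y k) t =
      vDeriv a b p x t + ∑ k, c k • vDeriv a b p (y k) t := by
  intro t ht
  have hu := uniqueDiffOn_Icc hab
  ext i
  simp only [vDeriv, Pi.add_apply, Finset.sum_apply, Pi.smul_apply, smul_eq_mul]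
  have h1 : ∀ k, ContDiffOn ℝ p (fun t => c k * y k t i) (Set.Icc a b) :=
    fun k => contDiffOn_const.mul (hy k i)
  rw [iteratedDerivWithin_fun_add ht hu (hx i t ht)
    (ContDiffOn.sum (fun k _ => h1 k) t ht)]
  rw [iteratedDerivWithin_fun_sum ht hu (fun k _ => h1 k t ht)]
  congr 1
  refine Finset.sum_congr rfl fun k _ => ?_
  rw [iteratedDerivWithin_const_mul ht hu _ (hy k i t ht)]

theorem Lop_lincomb {a b : ℝ} (hab : a < b) {r m : ℕ} {κ : Type*} [Fintype κ]
    (A : Fin r → ℝ → Matrix (Fin m) (Fin m) ℂ)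
    {x : ℝ → (Fin m → ℂ)} {y : κ → ℝ → (Fin m → ℂ)} (c : κ → ℂ)
    (hx : ∀ i, ContDiffOn ℝ r (fun t => x t i) (Set.Icc a b))
    (hy : ∀ k i, ContDiffOn ℝ r (fun t => y k t i) (Set.Icc a b)) :
    ∀ t ∈ Set.Icc a b, Lop a b r A (x + ∑ k, c k • y k) t =
      Lop a b r A x t + ∑ k, c k • Lop a b r A (y k) t := by
  intro t ht
  have hle : ∀ j : Fin r, ((j : ℕ) : WithTop ℕ∞) ≤ (r : ℕ) := fun j => by
    exact_mod_cast j.2.le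
  have hj : ∀ j : Fin r, vDeriv a b j (x + ∑ k, c k • y k) t =
      vDeriv a b j x t + ∑ k, c k • vDeriv a b j (y k) t := fun j =>
    vDeriv_lincomb hab c (fun i => (hx i).of_le (hle j)) (fun k i => (hy k i).of_le (hle j)) t ht
  simp only [Lop, vDeriv_lincomb hab c hx hy t ht, hj, Matrix.mulVec_add, Matrix.mulVec_sum,
    Matrix.mulVec_smul, smul_add, Finset.sum_add_distrib, Finset.smul_sum]
  rw [Finset.sum_comm (s := (Finset.univ : Finset (Fin r)))]
  abel

theorem iteratedDerivWithin_sub' {a b : ℝ} (hab : a < b) {p : ℕ} {x y : ℝ → ℂ}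
    (hx : ContDiffOn ℝ p x (Set.Icc a b)) (hy : ContDiffOn ℝ p y (Set.Icc a b)) :
    ∀ t ∈ Set.Icc a b, iteratedDerivWithin p (fun s => x s - y s) (Set.Icc a b) t =
      iteratedDerivWithin p x (Set.Icc a b) t - iteratedDerivWithin p y (Set.Icc a b) t :=
  fun t ht => iteratedDerivWithin_sub ht (uniqueDiffOn_Icc hab) (hx t ht) (hy t ht)

/-- The Lop operator is bounded by the size of the coefficients. -/
theorem Lop_bound {a b α : ℝ} (hab : a < b) (hα1 : α ≤ 1) (n r m : ℕ) (MA : ℝ) :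
    ∃ C, ∀ (A : Fin r → ℝ → Matrix (Fin m) (Fin m) ℂ) (M : ℝ) (x : ℝ → (Fin m → ℂ)),
      (∀ j i l, HB a b α n MA (fun t => A j t i l)) →
      (∀ i, HB a b α (n + r) M (fun t => x t i)) →
      ∀ i, HB a b α n (C * M) (fun t => Lop a b r A x t i) := by
  obtain ⟨C, hC, hmul⟩ := HB.mul_exists (α := α) hab hα1 n
  refine ⟨HB.emb a b α ^ r + r * (m * (C * (MA * HB.emb a b α ^ r))), fun A M x hA hx i => ?_⟩
  have h1 := (hx i).iter_le hab hα1 (le_refl r)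
  have h2 : HB a b α n (∑ j : Fin r, ∑ l : Fin m, C * (MA * (HB.emb a b α ^ r * M)))
      (fun t => ∑ j : Fin r, ∑ l : Fin m, A j t i l *
        iteratedDerivWithin j (fun s => x s l) (Set.Icc a b) t) := by
    refine HB.sum _ fun j _ => HB.sum _ fun l _ => ?_
    exact hmul _ _ _ _ (hA j i l) ((hx l).iter_le hab hα1 j.2.le)
  refine ((h1.add h2).mono (le_of_eq ?_)).congr fun t ht => ?_
  · simp; ring
  · simp [Lop, vDeriv, Matrix.mulVec, dotProduct]

theorem A_bound {a b α : ℝ} (hab : a < b) (hα0 : 0 < α) (hα1 : α ≤ 1) {n r m : ℕ}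
    (hr : 2 ≤ r) {ε₁ : ℝ} (hε₁ : 0 < ε₁)
    (A : ℝ → Fin r → ℝ → Matrix (Fin m) (Fin m) ℂ)
    (hA : ∀ ε ∈ Set.Ico (0 : ℝ) ε₁, ∀ j, mHolMem a b n α (A ε j))
    (Y : ℝ → Fin (r * m) → ℝ → (Fin m → ℂ))
    (hYm : ∀ ε ∈ Set.Ico (0 : ℝ) ε₁, ∀ k, vHolMem a b (n + r) α (Y ε k))
    (hYL : ∀ ε ∈ Set.Ico (0 : ℝ) ε₁, ∀ k, ∀ t ∈ Set.Icc a b, Lop a b r (A ε) (Y ε k) t = 0)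
    (hY0 : ∀ v : Fin (r * m) → ℂ, (∀ t ∈ Set.Icc a b, (∑ k, v k • Y 0 k) t = 0) → v = 0)
    (hlim : ∀ k, Tendsto (fun ε => vHolNorm a b (n + r) α (fun t => Y ε k t - Y 0 k t))
      (𝓝[>] 0) (𝓝 0)) :
    ∃ MA, ∀ᶠ ε in 𝓝[>] (0 : ℝ), ∀ j i l, HB a b α n MA (fun t => A ε j t i l) := by
  have hu := uniqueDiffOn_Icc hab
  have h00 : (0 : ℝ) ∈ Set.Ico (0 : ℝ) ε₁ := ⟨le_rfl, hε₁⟩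
  let w : ℝ → (Fin r × Fin m) → Fin (r * m) → ℝ → ℂ := fun ε p k t =>
    iteratedDerivWithin p.1 (fun s => Y ε k s p.2) (Set.Icc a b) t
  -- common size of coefficients
  let S : ℝ → ℝ := fun ε => ∑ j : Fin r, mHolNorm a b n α (A ε j)
  have hS : ∀ ε ∈ Set.Ico (0 : ℝ) ε₁, ∀ j i l, HB a b α n (S ε) (fun t => A ε j t i l) := by
    intro ε hε j i l
    refine ((hA ε hε j i l).hb hab).mono ?_
    have hn := fun j i l => holNorm_nonneg a b n α (fun t => A ε j t i l)
    have e1 := Finset.single_le_sum (f := fun l => holNorm a b n α (fun t => A ε j t i l))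
      (fun l _ => hn j i l) (Finset.mem_univ l)
    have e2 := Finset.single_le_sum (f := fun i => ∑ l, holNorm a b n α (fun t => A ε j t i l))
      (fun i _ => Finset.sum_nonneg fun l _ => hn j i l) (Finset.mem_univ i)
    have e3 := Finset.single_le_sum (f := fun j => mHolNorm a b n α (A ε j))
      (fun j _ => Finset.sum_nonneg fun i _ => Finset.sum_nonneg fun l _ => hn j i l)
      (Finset.mem_univ j)
    exact e1.trans (e2.trans e3)
  -- the inverse Wronskian at zero
  obtain ⟨Q, hQc, hQ⟩ := exists_inverse (ι := Fin r × Fin m) (κ := Fin (r * m)) (by simp)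
    (s := Set.Icc a b) (N := n + 1) (W := fun t => Matrix.of fun p k => w 0 p k t)
    (by
      intro p k
      have h1 := (hYm 0 h00 k).hb hab p.2
      have h2 : n + r = (n + (r - p.1)) + p.1 := by have := p.1.2; omega
      rw [h2] at h1
      have h3 := (h1.iter hab p.1).contDiffOn hab hα0
      exact h3.of_le (by exact_mod_cast (by have := p.1.2; omega : n + 1 ≤ n + (r - p.1))))
    (by
      intro t ht v hv
      refine hY0 v ?_
      have hmem : ∀ k i, ContDiffOn ℝ r (fun t => Y 0 k t i) (Set.Icc a b) := fun k i =>
        (hYm 0 h00 k i).1.of_le (by exact_mod_cast (by omega : r ≤ n + r))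
      have hx0 : ∀ i : Fin m, ContDiffOn ℝ r (fun t => (0 : ℝ → Fin m → ℂ) t i) (Set.Icc a b) :=
        fun i => contDiffOn_const
      have hvd : ∀ p : ℕ, ∀ t, vDeriv a b p (0 : ℝ → Fin m → ℂ) t = 0 := by
        intro p t; ext i; simp [vDeriv]
      have hL0 : ∀ t, Lop a b r (A 0) (0 : ℝ → Fin m → ℂ) t = 0 := by
        intro t; simp [Lop, hvd]
      refine zero_of_cauchy (α := α) (n := n) hab hr (A := A 0) (MA := S 0)
        (fun j i l => (hS 0 h00 j i l).bound) ?_ ?_ ht ?_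
      · intro i
        have : HB a b α (n + r) (∑ k, ‖v k‖ * vHolNorm a b (n + r) α (Y 0 k))
            (fun t => (∑ k, v k • Y 0 k) t i) := by
          refine (HB.sum Finset.univ fun k _ =>
            ((hYm 0 h00 k).hb hab i).smul (v k)).congr fun t _ => ?_
          simp [Finset.sum_apply]
        exact this.holMem hab hα0
      · intro t ht
        have := Lop_lincomb hab (A 0) v hx0 hmem t ht
        rw [zero_add, hL0, zero_add] at this
        rw [this]
        exact Finset.sum_eq_zero fun k _ => by rw [hYL 0 h00 k t ht, smul_zero]
      · intro j i
        have hle : ((j : ℕ) : WithTop ℕ∞) ≤ (r : ℕ) := by exact_mod_cast j.2.le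
        have h1 := vDeriv_lincomb hab v (fun i => (hx0 i).of_le hle)
          (fun k i => (hmem k i).of_le hle) t ht
        rw [zero_add, hvd, zero_add] at h1
        have h2 := congrFun h1 i
        have h3 := congrFun hv (j, i)
        simp only [vDeriv] at h2
        rw [h2]
        simp only [Matrix.mulVec, dotProduct, Matrix.of_apply, w, Pi.zero_apply] at h3
        simp only [Finset.sum_apply, Pi.smul_apply, smul_eq_mul, vDeriv]
        rw [← h3]
        exact Finset.sum_congr rfl fun k _ => mul_comm _ _)
  -- a bound for Q
  choose MQ' hMQ' using fun k p => HB.of_contDiffOn (α := α) hab hα1 (hQc k p)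
  obtain ⟨MQ, hMQ⟩ : ∃ MQ, ∀ k p, HB a b α n MQ (fun t => Q t k p) := by
    refine ⟨∑ k, ∑ p, MQ' k p, fun k p => (hMQ' k p).mono ?_⟩
    have hn := fun k p => (hMQ' k p).nonneg hab
    have e1 := Finset.single_le_sum (f := fun p => MQ' k p) (fun p _ => hn k p)
      (Finset.mem_univ p)
    have e2 := Finset.single_le_sum (f := fun k => ∑ p, MQ' k p)
      (fun k _ => Finset.sum_nonneg fun p _ => hn k p) (Finset.mem_univ k)
    exact e1.trans e2
  obtain ⟨C, hC, hmul⟩ := HB.mul_exists (α := α) hab hα1 n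
  let d : ℝ → ℝ := fun ε => ∑ k, vHolNorm a b (n + r) α (fun t => Y ε k t - Y 0 k t)
  have hd0 : Tendsto d (𝓝[>] 0) (𝓝 0) := by
    have := tendsto_finsetSum (Finset.univ : Finset (Fin (r * m))) fun k _ => hlim k
    simpa using this
  let D : ℝ := ∑ k, vHolNorm a b (n + r) α (Y 0 k)
  let E : ℝ := HB.emb a b α ^ r
  have hsubm : ∀ ε ∈ Set.Ico (0 : ℝ) ε₁, ∀ k,
      vHolMem a b (n + r) α (fun t => Y ε k t - Y 0 k t) := by
    intro ε hε k i
    exact (((hYm ε hε k).hb hab i).sub ((hYm 0 h00 k).hb hab i)).holMem hab hα0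
  have hdiff : ∀ ε ∈ Set.Ico (0 : ℝ) ε₁, ∀ k i,
      HB a b α (n + r) (d ε) (fun t => Y ε k t i - Y 0 k t i) := by
    intro ε hε k i
    refine ((hsubm ε hε k).hb hab i).mono ?_
    exact Finset.single_le_sum
      (f := fun k => vHolNorm a b (n + r) α (fun t => Y ε k t - Y 0 k t))
      (fun _ _ => vHolNorm_nonneg _ _ _ _ _) (Finset.mem_univ k)
  have hYD : ∀ ε ∈ Set.Ico (0 : ℝ) ε₁, ∀ k i,
      HB a b α (n + r) (d ε + D) (fun t => Y ε k t i) := by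
    intro ε hε k i
    have h1 : HB a b α (n + r) D (fun t => Y 0 k t i) := by
      refine ((hYm 0 h00 k).hb hab i).mono ?_
      exact Finset.single_le_sum (f := fun k => vHolNorm a b (n + r) α (Y 0 k))
        (fun _ _ => vHolNorm_nonneg _ _ _ _ _) (Finset.mem_univ k)
    exact ((hdiff ε hε k i).add h1).congr fun t _ => by ring
  have hwd : ∀ ε ∈ Set.Ico (0 : ℝ) ε₁, ∀ p k,
      HB a b α n (E * d ε) (fun t => w 0 p k t - w ε p k t) := by
    intro ε hε p k
    refine (((hdiff ε hε k p.2).iter_le hab hα1 p.1.2.le).neg).congr fun t ht => ?_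
    have hle : ((p.1 : ℕ) : WithTop ℕ∞) ≤ (n + r : ℕ) := by
      exact_mod_cast (by have := p.1.2; omega : (p.1 : ℕ) ≤ n + r)
    rw [iteratedDerivWithin_sub' hab ((hYm ε hε k p.2).1.of_le hle)
      ((hYm 0 h00 k p.2).1.of_le hle) t ht]
    simp [w]
  have hform : ∀ ε ∈ Set.Ico (0 : ℝ) ε₁, ∀ j i l, ∀ t ∈ Set.Icc a b, A ε j t i l =
      (∑ k, (∑ p : Fin r × Fin m, A ε p.1 t i p.2 * (w 0 p k t - w ε p k t)) * Q t k (j, l)) -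
        ∑ k, iteratedDerivWithin r (fun s => Y ε k s i) (Set.Icc a b) t * Q t k (j, l) := by
    intro ε hε j i l t ht
    have h1 : ∀ k, iteratedDerivWithin r (fun s => Y ε k s i) (Set.Icc a b) t =
        - ∑ p : Fin r × Fin m, A ε p.1 t i p.2 * w ε p k t := by
      intro k
      have h1 := congrFun (hYL ε hε k t ht) i
      simp only [Lop, vDeriv, Pi.add_apply, Finset.sum_apply, Matrix.mulVec, dotProduct,
        Pi.zero_apply] at h1
      rw [Fintype.sum_prod_type]
      exact eq_neg_of_add_eq_zero_left h1
    rw [← Finset.sum_sub_distrib]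
    have h2 : ∀ k, (∑ p : Fin r × Fin m, A ε p.1 t i p.2 * (w 0 p k t - w ε p k t)) * Q t k (j, l)
        - iteratedDerivWithin r (fun s => Y ε k s i) (Set.Icc a b) t * Q t k (j, l) =
        ∑ p : Fin r × Fin m, A ε p.1 t i p.2 * (w 0 p k t * Q t k (j, l)) := by
      intro k
      rw [h1 k, ← sub_mul, sub_neg_eq_add, ← Finset.sum_add_distrib, Finset.sum_mul]
      exact Finset.sum_congr rfl fun p _ => by ring
    simp only [h2]
    rw [Finset.sum_comm]
    simp only [← Finset.mul_sum]
    have h3 : ∀ p : Fin r × Fin m, ∑ k, w 0 p k t * Q t k (j, l) = if p = (j, l) then 1 else 0 := by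
      intro p
      have := congrFun (congrFun (hQ t ht) p) (j, l)
      simpa [Matrix.mul_apply, Matrix.one_apply] using this
    simp [h3]
  have hest : ∀ ε ∈ Set.Ico (0 : ℝ) ε₁, ∀ j i l, HB a b α n
      ((∑ k : Fin (r * m), C * ((∑ p : Fin r × Fin m, C * (S ε * (E * d ε))) * MQ)) +
        ∑ k : Fin (r * m), C * ((E * (d ε + D)) * MQ)) (fun t => A ε j t i l) := by
    intro ε hε j i l
    refine (HB.sub (HB.sum _ fun k _ => hmul _ _ _ _ (HB.sum _ fun p _ =>
      hmul _ _ _ _ (hS ε hε p.1 i p.2) (hwd ε hε p k)) (hMQ k (j, l)))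
      (HB.sum _ fun k _ => hmul _ _ _ _ ((hYD ε hε k i).iter_le hab hα1 le_rfl)
        (hMQ k (j, l)))).congr fun t ht => hform ε hε j i l t ht
  let P : ℝ := (r * m) * (C * ((r * m) * (C * E)) * MQ)
  let R : ℝ := (r * m) * (C * E * MQ)
  let G : ℝ := r * (m * (m * (n + 2)))
  have hS2 : ∀ ε ∈ Set.Ico (0 : ℝ) ε₁, S ε ≤ G * (P * (S ε * d ε) + R * (d ε + D)) := by
    intro ε hε
    have : S ε ≤ ∑ j : Fin r, ∑ i : Fin m, ∑ l : Fin m, ((n + 2) *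
      ((∑ k : Fin (r * m), C * ((∑ p : Fin r × Fin m, C * (S ε * (E * d ε))) * MQ)) +
        ∑ k : Fin (r * m), C * ((E * (d ε + D)) * MQ)) : ℝ) :=
      Finset.sum_le_sum fun j _ => Finset.sum_le_sum fun i _ => Finset.sum_le_sum fun l _ =>
        (hest ε hε j i l).holNorm_le hab
    refine this.trans (le_of_eq ?_)
    simp only [Finset.sum_const, Finset.card_univ, Fintype.card_fin, Fintype.card_prod,
      nsmul_eq_mul, Nat.cast_mul, G, P, R]
    ring
  refine ⟨2 * (|G * R| * (1 + |D|)), ?_⟩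
  have hd1 : ∀ᶠ ε in 𝓝[>] (0 : ℝ), d ε < 1 := hd0.eventually_lt_const one_pos
  have hd2 : ∀ᶠ ε in 𝓝[>] (0 : ℝ), G * P * d ε < 1 / 2 := by
    have : Tendsto (fun ε => G * P * d ε) (𝓝[>] 0) (𝓝 0) := by
      simpa using hd0.const_mul (G * P)
    exact this.eventually_lt_const (by norm_num)
  have hd3 : ∀ᶠ ε in 𝓝[>] (0 : ℝ), ε < ε₁ :=
    (eventually_lt_nhds hε₁).filter_mono nhdsWithin_le_nhds
  filter_upwards [hd1, hd2, hd3, self_mem_nhdsWithin] with ε h1 h2 h3 h4 j i l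
  have hε : ε ∈ Set.Ico (0 : ℝ) ε₁ := ⟨le_of_lt h4, h3⟩
  refine (hS ε hε j i l).mono ?_
  have hS0 := (hS ε hε j i l).nonneg hab
  have hdn : 0 ≤ d ε := Finset.sum_nonneg fun _ _ => vHolNorm_nonneg _ _ _ _ _
  have hm := hS2 ε hε
  have e1 : G * P * d ε * S ε ≤ 1 / 2 * S ε := mul_le_mul_of_nonneg_right h2.le hS0
  have e2 : G * R * (d ε + D) ≤ |G * R| * (1 + |D|) := by
    refine (le_abs_self _).trans ?_
    rw [abs_mul]
    refine mul_le_mul_of_nonneg_left ?_ (abs_nonneg _)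
    refine (abs_add_le _ _).trans ?_
    rw [abs_of_nonneg hdn]
    linarith
  nlinarith

/-- If the solution depends continuously on ε at ε = 0 (conditions (∗) and (∗∗)), then
the operator norms of B(ε) are O(1) as ε → 0+: there are K > 0 and ε' ∈ (0, ε₀) with
‖B(ε)y‖ ≤ K ‖y‖_{n+r,α} for all ε ∈ (0, ε') and all y of class C^{n+r,α}. -/
theorem continuous_dependence_implies_B_bounded
    (a b : ℝ) (hab : a < b) (n : ℕ) (α : ℝ) (hα0 : 0 < α) (hα1 : α ≤ 1)
    (m r : ℕ) (hm : 1 ≤ m) (hr : 2 ≤ r) (ε₀ : ℝ) (hε₀ : 0 < ε₀)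
    (A : ℝ → Fin r → ℝ → Matrix (Fin m) (Fin m) ℂ)
    (hA : ∀ ε ∈ Set.Ico (0 : ℝ) ε₀, ∀ j, mHolMem a b n α (A ε j))
    (B : ℝ → (ℝ → (Fin m → ℂ)) →ₗ[ℂ] (Fin (r * m) → ℂ))
    (hB : ∀ ε ∈ Set.Ico (0 : ℝ) ε₀, ∃ K : ℝ, ∀ y : ℝ → (Fin m → ℂ),
      vHolMem a b (n + r) α y → ‖B ε y‖ ≤ K * vHolNorm a b (n + r) α y)
    (ε₁ : ℝ) (hε₁0 : 0 < ε₁) (hε₁ : ε₁ < ε₀)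
    (hstar : CondStar a b n α r m ε₁ A B)
    (hstarstar : CondStarStar a b n α r m ε₁ A B) :
    ∃ K ε' : ℝ, 0 < K ∧ 0 < ε' ∧ ε' < ε₀ ∧
      ∀ ε ∈ Set.Ioo (0 : ℝ) ε', ∀ y : ℝ → (Fin m → ℂ), vHolMem a b (n + r) α y →
        ‖B ε y‖ ≤ K * vHolNorm a b (n + r) α y := by
  have h00 : (0 : ℝ) ∈ Set.Ico (0 : ℝ) ε₁ := ⟨le_rfl, hε₁0⟩
  have hlt : ∀ ε ∈ Set.Ico (0 : ℝ) ε₁, ε ∈ Set.Ico (0 : ℝ) ε₀ := fun ε hε =>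
    ⟨hε.1, hε.2.trans hε₁⟩
  have hz : ∀ N : ℕ, vHolMem a b N α (fun _ => (0 : Fin m → ℂ)) := fun N i =>
    (HB.zero (n := N)).holMem hab hα0
  have hzn : ∀ N : ℕ, vHolNorm a b N α (fun _ => (0 : Fin m → ℂ)) = 0 := fun N => by
    refine le_antisymm ?_ (vHolNorm_nonneg _ _ _ _ _)
    refine (vHolNorm_le (M := 0) hab fun i => HB.zero).trans ?_
    simp
  have hBz : ∀ ε ∈ Set.Ico (0 : ℝ) ε₀, ∀ y : ℝ → (Fin m → ℂ),
      (∀ t ∈ Set.Icc a b, y t = 0) → B ε y = 0 := by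
    intro ε hε y hy
    obtain ⟨K, hK⟩ := hB ε hε
    have hb : ∀ i, HB a b α (n + r) 0 (fun t => y t i) := fun i =>
      HB.zero.congr fun t ht => by rw [hy t ht]; rfl
    have h0 : vHolNorm a b (n + r) α y = 0 := by
      refine le_antisymm ?_ (vHolNorm_nonneg _ _ _ _ _)
      refine (vHolNorm_le hab hb).trans ?_
      simp
    have := hK y fun i => (hb i).holMem hab hα0
    rw [h0, mul_zero] at this
    simpa using this
  -- the fundamental solutions
  have hex : ∀ ε k, ∃ y : ℝ → (Fin m → ℂ), ε ∈ Set.Ico (0 : ℝ) ε₁ →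
      IsSol a b n α r m (A ε) (B ε) (fun _ => 0) (Pi.single k 1) y := by
    intro ε k
    by_cases hε : ε ∈ Set.Ico (0 : ℝ) ε₁
    · obtain ⟨y, hy, _⟩ := hstar ε hε (fun _ => 0) (hz n) (Pi.single k 1)
      exact ⟨y, fun _ => hy⟩
    · exact ⟨0, fun h => absurd h hε⟩
  choose Y hY using hex
  have hlim : ∀ k, Tendsto (fun ε => vHolNorm a b (n + r) α (fun t => Y ε k t - Y 0 k t))
      (𝓝[>] 0) (𝓝 0) := by
    intro k
    refine hstarstar (fun _ _ => 0) (fun _ => Pi.single k 1) (fun ε => Y ε k)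
      (fun ε hε => ⟨hz n, hY ε k hε⟩) ?_ tendsto_const_nhds
    simp only [sub_self, hzn]
    exact tendsto_const_nhds
  have hYB : ∀ ε ∈ Set.Ico (0 : ℝ) ε₁, ∀ v : Fin (r * m) → ℂ, B ε (∑ k, v k • Y ε k) = v := by
    intro ε hε v
    rw [map_sum]
    ext q
    simp [(hY ε _ hε).2.2, Finset.sum_apply, Pi.single_apply]
  obtain ⟨MA, hMA⟩ := A_bound hab hα0 hα1 hr hε₁0 A (fun ε hε => hA ε (hlt ε hε)) Y
    (fun ε hε k => (hY ε k hε).1) (fun ε hε k => (hY ε k hε).2.1)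
    (fun v hv => by rw [← hYB 0 h00 v]; exact hBz 0 (hlt 0 h00) _ hv) hlim
  obtain ⟨C, hC⟩ := Lop_bound (α := α) hab hα1 n r m MA
  by_contra hcon
  push Not at hcon
  obtain ⟨s, hs, hfreq⟩ := exists_index (P := fun k ε => ε ∈ Set.Ioo (0 : ℝ) ε₁ ∧
      ∃ x : ℝ → (Fin m → ℂ), vHolMem a b (n + r) α x ∧ ‖B ε x‖ = 1 ∧
        ∀ i, HB a b α (n + r) (1 / ((k : ℝ) + 1)) (fun t => x t i)) (by
    intro k δ hδ
    obtain ⟨ε, hε, y, hy, hlt'⟩ := hcon (k + 1) (min δ ε₁) (by positivity)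
      (lt_min hδ hε₁0) ((min_le_right _ _).trans_lt hε₁)
    refine ⟨ε, ⟨hε.1, hε.2.trans_le (min_le_left _ _)⟩,
      ⟨hε.1, hε.2.trans_le (min_le_right _ _)⟩, ?_⟩
    have hN := vHolNorm_nonneg a b (n + r) α y
    have hpos : 0 < ‖B ε y‖ := lt_of_le_of_lt (by positivity) hlt'
    have hb : ∀ i, HB a b α (n + r) (1 / ((k : ℝ) + 1))
        (fun t => (((‖B ε y‖⁻¹ : ℝ) : ℂ) • y) t i) := by
      intro i
      refine ((hy.hb hab i).smul ((‖B ε y‖⁻¹ : ℝ) : ℂ)).mono ?_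
      rw [Complex.norm_real, Real.norm_of_nonneg (by positivity), inv_mul_le_iff₀ hpos,
        mul_one_div, le_div_iff₀ (by positivity)]
      linarith
    refine ⟨((‖B ε y‖⁻¹ : ℝ) : ℂ) • y, fun i => (hb i).holMem hab hα0, ?_, hb⟩
    rw [map_smul, norm_smul, Complex.norm_real, Real.norm_of_nonneg (by positivity)]
    exact inv_mul_cancel₀ hpos.ne')
  -- a family defined for all parameters
  have hfam : ∀ ε, ∃ x : ℝ → (Fin m → ℂ),
      (∀ i, HB a b α (n + r) (1 / ((s ε : ℝ) + 1)) (fun t => x t i)) ∧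
      (ε ∈ Set.Ico (0 : ℝ) ε₁ → ‖B ε x‖ ≤ 1) ∧
      ((ε ∈ Set.Ioo (0 : ℝ) ε₁ ∧ ∃ x : ℝ → (Fin m → ℂ), vHolMem a b (n + r) α x ∧ ‖B ε x‖ = 1 ∧
        ∀ i, HB a b α (n + r) (1 / ((s ε : ℝ) + 1)) (fun t => x t i)) → ‖B ε x‖ = 1) ∧
      (ε = 0 → x = 0) := by
    intro ε
    by_cases h : (ε ∈ Set.Ioo (0 : ℝ) ε₁ ∧ ∃ x : ℝ → (Fin m → ℂ),
        vHolMem a b (n + r) α x ∧ ‖B ε x‖ = 1 ∧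
        ∀ i, HB a b α (n + r) (1 / ((s ε : ℝ) + 1)) (fun t => x t i))
    · obtain ⟨hε, x, hx, hx1, hxb⟩ := h
      exact ⟨x, hxb, fun _ => hx1.le, fun _ => hx1, fun h => absurd h hε.1.ne'⟩
    · refine ⟨0, fun i => HB.zero.mono (by positivity), fun _ => by simp, fun h' => absurd h' h,
        fun _ => rfl⟩
  choose x hxb hx1 hx2 hx0 using hfam
  have hs0 : Tendsto (fun ε => 1 / ((s ε : ℝ) + 1)) (𝓝[>] (0 : ℝ)) (𝓝 0) :=
    tendsto_one_div_add_atTop_nhds_zero_nat.comp hs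
  let η : ℝ → ℝ := fun ε => 1 / ((s ε : ℝ) + 1)
  let c : ℝ → Fin (r * m) → ℂ := fun ε => B ε (x ε)
  let u : ℝ → ℝ → (Fin m → ℂ) := fun ε => x ε + ∑ k, (-c ε k) • Y ε k
  have hc1 : ∀ ε ∈ Set.Ico (0 : ℝ) ε₁, ∀ k, ‖c ε k‖ ≤ 1 := fun ε hε k =>
    (norm_le_pi_norm (c ε) k).trans (hx1 ε hε)
  have hum : ∀ ε ∈ Set.Ico (0 : ℝ) ε₁, vHolMem a b (n + r) α (u ε) := by
    intro ε hε i
    refine HB.holMem (M := η ε + ∑ k, ‖-c ε k‖ * vHolNorm a b (n + r) α (Y ε k)) hab hα0 ?_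
    refine ((hxb ε i).add (HB.sum Finset.univ fun k _ =>
      ((hY ε k hε).1.hb hab i).smul (-c ε k))).congr fun t _ => ?_
    simp [u, Finset.sum_apply]
  have hcd : ∀ {y : ℝ → (Fin m → ℂ)}, vHolMem a b (n + r) α y → ∀ i,
      ContDiffOn ℝ r (fun t => y t i) (Set.Icc a b) := fun h i =>
    (h i).1.of_le (by exact_mod_cast (by omega : r ≤ n + r))
  have hxm : ∀ ε, vHolMem a b (n + r) α (x ε) := fun ε i => (hxb ε i).holMem hab hα0
  have huL : ∀ ε ∈ Set.Ico (0 : ℝ) ε₁, ∀ t ∈ Set.Icc a b,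
      Lop a b r (A ε) (u ε) t = Lop a b r (A ε) (x ε) t := by
    intro ε hε t ht
    rw [Lop_lincomb hab (A ε) (fun k => -c ε k) (hcd (hxm ε)) (fun k => hcd (hY ε k hε).1) t ht]
    rw [Finset.sum_eq_zero fun k _ => by rw [(hY ε k hε).2.1 t ht, smul_zero], add_zero]
  have huB : ∀ ε ∈ Set.Ico (0 : ℝ) ε₁, B ε (u ε) = 0 := by
    intro ε hε
    have := hYB ε hε (fun k => -c ε k)
    simp only [u, map_add, this]
    ext k; simp [c]
  have hu0 : ∀ t, u 0 t = 0 := by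
    intro t
    have h := hx0 0 rfl
    simp [u, c, h]
  -- apply continuity to the family u
  have hev : ∀ᶠ ε in 𝓝[>] (0 : ℝ), ε ∈ Set.Ico (0 : ℝ) ε₁ := by
    filter_upwards [(eventually_lt_nhds hε₁0).filter_mono nhdsWithin_le_nhds,
      self_mem_nhdsWithin] with ε h1 h2
    exact ⟨le_of_lt h2, h1⟩
  have hL0 : ∀ t, Lop a b r (A 0) (x 0) t = 0 := by
    intro t
    have hvd : ∀ p : ℕ, ∀ t, vDeriv a b p (0 : ℝ → Fin m → ℂ) t = 0 := by
      intro p t; ext i; simp [vDeriv]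
    rw [hx0 0 rfl]
    simp [Lop, hvd]
  have hut : Tendsto (fun ε => vHolNorm a b (n + r) α (fun t => u ε t - u 0 t))
      (𝓝[>] 0) (𝓝 0) := by
    refine hstarstar (fun ε => Lop a b r (A ε) (x ε)) (fun _ => 0) u ?_ ?_ tendsto_const_nhds
    · intro ε hε
      refine ⟨fun i => ?_, hum ε hε, huL ε hε, huB ε hε⟩
      obtain ⟨C', hC'⟩ := Lop_bound (α := α) hab hα1 n r m
        (∑ j, mHolNorm a b n α (A ε j))
      refine (hC' (A ε) _ (x ε) ?_ (hxb ε) i).holMem hab hα0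
      intro j i l
      refine ((hA ε (hlt ε hε) j i l).hb hab).mono ?_
      have hn := fun j i l => holNorm_nonneg a b n α (fun t => A ε j t i l)
      have e1 := Finset.single_le_sum (f := fun l => holNorm a b n α (fun t => A ε j t i l))
        (fun l _ => hn j i l) (Finset.mem_univ l)
      have e2 := Finset.single_le_sum
        (f := fun i => ∑ l, holNorm a b n α (fun t => A ε j t i l))
        (fun i _ => Finset.sum_nonneg fun l _ => hn j i l) (Finset.mem_univ i)
      have e3 := Finset.single_le_sum (f := fun j => mHolNorm a b n α (A ε j))
        (fun j _ => Finset.sum_nonneg fun i _ => Finset.sum_nonneg fun l _ => hn j i l)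
        (Finset.mem_univ j)
      exact e1.trans (e2.trans e3)
    · have hup : Tendsto (fun ε => (m : ℝ) * ((n + 2) * (C * η ε))) (𝓝[>] 0) (𝓝 0) := by
        simpa only [mul_zero] using ((hs0.const_mul C).const_mul ((n : ℝ) + 2)).const_mul (m : ℝ)
      refine tendsto_of_tendsto_of_tendsto_of_le_of_le' tendsto_const_nhds hup
        (Eventually.of_forall fun ε => vHolNorm_nonneg _ _ _ _ _) ?_
      filter_upwards [hMA] with ε hε
      refine vHolNorm_le hab fun i => ?_
      simp only [hL0, sub_zero]
      exact hC (A ε) _ (x ε) hε (hxb ε) i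
  -- the combination of limit fundamental solutions tends to zero
  let d : ℝ → ℝ := fun ε => ∑ k, vHolNorm a b (n + r) α (fun t => Y ε k t - Y 0 k t)
  have hd0 : Tendsto d (𝓝[>] 0) (𝓝 0) := by
    have := tendsto_finsetSum (Finset.univ : Finset (Fin (r * m))) fun k _ => hlim k
    simpa using this
  have hzb : ∀ ε ∈ Set.Ico (0 : ℝ) ε₁, ∀ i, HB a b α (n + r)
      (η ε + vHolNorm a b (n + r) α (fun t => u ε t - u 0 t) + d ε)
      (fun t => (∑ k, c ε k • Y 0 k) t i) := by
    intro ε hε i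
    have h1 : vHolMem a b (n + r) α (fun t => u ε t - u 0 t) := by
      simpa only [hu0, sub_zero] using hum ε hε
    have h2 : HB a b α (n + r) (d ε) (fun t => ∑ k, c ε k * (Y ε k t i - Y 0 k t i)) := by
      refine HB.sum _ fun k _ => ?_
      have h3 : vHolMem a b (n + r) α (fun t => Y ε k t - Y 0 k t) := fun i =>
        (((hY ε k hε).1.hb hab i).sub ((hY 0 k h00).1.hb hab i)).holMem hab hα0
      refine ((h3.hb hab i).smul (c ε k)).mono ?_
      exact mul_le_of_le_one_left (vHolNorm_nonneg _ _ _ _ _) (hc1 ε hε k)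
    refine (((hxb ε i).sub (h1.hb hab i)).sub h2).congr fun t _ => ?_
    simp only [hu0, u, Finset.sum_apply, Pi.add_apply, Pi.smul_apply, smul_eq_mul, sub_zero,
      mul_sub, Finset.sum_sub_distrib, neg_mul, Finset.sum_neg_distrib]
    ring
  obtain ⟨K, hK⟩ := hB 0 (hlt 0 h00)
  have hcle : ∀ ε ∈ Set.Ico (0 : ℝ) ε₁, ‖c ε‖ ≤ |K| * ((m : ℝ) * (((n + r : ℕ) + 2) *
      (η ε + vHolNorm a b (n + r) α (fun t => u ε t - u 0 t) + d ε))) := by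
    intro ε hε
    have h1 := hK (∑ k, c ε k • Y 0 k) fun i => (hzb ε hε i).holMem hab hα0
    rw [hYB 0 h00 (c ε)] at h1
    refine h1.trans ?_
    refine (mul_le_mul_of_nonneg_right (le_abs_self K) (vHolNorm_nonneg _ _ _ _ _)).trans ?_
    exact mul_le_mul_of_nonneg_left (vHolNorm_le hab (hzb ε hε)) (abs_nonneg _)
  have hfin : Tendsto (fun ε => |K| * ((m : ℝ) * (((n + r : ℕ) + 2) *
      (η ε + vHolNorm a b (n + r) α (fun t => u ε t - u 0 t) + d ε)))) (𝓝[>] 0) (𝓝 0) := by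
    have := ((((hs0.add hut).add hd0).const_mul (((n + r : ℕ) : ℝ) + 2)).const_mul
      (m : ℝ)).const_mul |K|
    simpa only [add_zero, mul_zero] using this
  have hlast : ∀ᶠ ε in 𝓝[>] (0 : ℝ), ‖c ε‖ < 1 := by
    filter_upwards [hev, hfin.eventually_lt_const one_pos] with ε h1 h2
    exact (hcle ε h1).trans_lt h2
  obtain ⟨ε, h1, h2⟩ := (hfreq.and_eventually hlast).exists
  have := hx2 ε h1
  simp only [c] at h2
  linarith
end
end

section
/- Suppose that the operator (L(ε), B(ε)) converges strongly to (L(0), B(0)) as ε → 0+, i.e., (L(ε)y, B(ε)y) → (L(0)y, B(0)y) in (C^{n,α})^m × ℂ^{rm} for every y ∈ (C^{n+r,α})^m, and that the limit operator (L(0), B(0)) : (C^{n+r,α})^m → (C^{n,α})^m × ℂ^{rm} is invertible. Then there exists ε₁ ∈ (0, ε₀) such that (L(ε), B(ε)) is invertible for every ε ∈ [0, ε₁), and the inverses converge strongly: (L(ε), B(ε))^{-1}(f, c) → (L(0), B(0))^{-1}(f, c) in (C^{n+r,α})^m as ε → 0+ for all f ∈ (C^{n,α})^m and c ∈ ℂ^{rm}.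 -/
open Set Filter Topology

noncomputable section

theorem abs_main {X Y : Type*} [NormedAddCommGroup X] [NormedSpace ℂ X] [CompleteSpace X]
    [NormedAddCommGroup Y] [NormedSpace ℂ Y] {k : ℕ}
    (L : ℝ → X →L[ℂ] Y) (B : ℝ → X →L[ℂ] (Fin k → ℂ))
    (hL : Tendsto L (𝓝[>] 0) (𝓝 (L 0)))
    (hB : ∀ x, Tendsto (fun ε => B ε x) (𝓝[>] 0) (𝓝 (B 0 x)))
    (hsurj : ∀ f c, ∃ x, L 0 x = f ∧ B 0 x = c)
    (κ : ℝ) (hκ : ∀ x, ‖x‖ ≤ κ * (‖L 0 x‖ + ‖B 0 x‖)) :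
    ∃ M : ℝ, 0 < M ∧ ∀ᶠ ε in 𝓝[>] (0 : ℝ), (∀ f c, ∃ x, L ε x = f ∧ B ε x = c) ∧
      ∀ x, ‖x‖ ≤ M * (‖L ε x‖ + ‖B ε x‖) := by
  -- uniform bound
  obtain ⟨K, hK⟩ : ∃ K : ℝ, ∀ᶠ ε in 𝓝[>] (0 : ℝ), ‖B ε‖ ≤ K := by
    by_contra hcon
    push Not at hcon
    obtain ⟨u, hu⟩ := exists_seq_tendsto (𝓝[>] (0:ℝ))
    have hev : ∀ N : ℕ, ∃ᶠ ε in 𝓝[>] (0 : ℝ), (N : ℝ) < ‖B ε‖ := fun N => by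
      exact hcon N
    obtain ⟨ψ, hψ1, hψ2⟩ : ∃ ψ : ℕ → ℝ, Tendsto ψ atTop (𝓝[>] 0) ∧ ∀ N : ℕ, (N : ℝ) < ‖B (ψ N)‖ := by
      obtain ⟨s, hs⟩ := (𝓝[>] (0:ℝ)).exists_antitone_basis
      have : ∀ N : ℕ, ∃ e, (N : ℝ) < ‖B e‖ ∧ e ∈ s N := fun N =>
        ((hev N).and_eventually (hs.1.mem_of_mem trivial)).exists
      choose ψ h1 h2 using this
      exact ⟨ψ, hs.tendsto h2, h1⟩
    obtain ⟨C, hC⟩ := banach_steinhaus (g := fun N => B (ψ N)) (fun x => by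
      obtain ⟨C, hC⟩ := (((hB x).comp hψ1).norm.bddAbove_range)
      exact ⟨C, fun i => hC ⟨i, rfl⟩⟩)
    obtain ⟨N, hN⟩ := exists_nat_gt C
    exact absurd (hC N) (not_le.2 (hN.trans (hψ2 N)))
  -- the inverse of the limit
  let T0 : X →L[ℂ] Y × (Fin k → ℂ) := (L 0).prod (B 0)
  have hinj : Function.Injective T0 := by
    rw [injective_iff_map_eq_zero]
    intro x hx
    have h1 : L 0 x = 0 := congrArg Prod.fst hx
    have h2 : B 0 x = 0 := congrArg Prod.snd hx
    have := hκ x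
    rw [h1, h2] at this
    simpa using this
  have hsur : Function.Surjective T0 := by
    rintro ⟨f, c⟩
    obtain ⟨x, h1, h2⟩ := hsurj f c
    exact ⟨x, Prod.ext h1 h2⟩
  have hκ2 : ∀ x, ‖x‖ ≤ |κ| * 2 * ‖T0 x‖ := fun x => by
    refine (hκ x).trans ?_
    have h1 : ‖L 0 x‖ ≤ ‖T0 x‖ := norm_fst_le (T0 x)
    have h2 : ‖B 0 x‖ ≤ ‖T0 x‖ := norm_snd_le (T0 x)
    calc κ * (‖L 0 x‖ + ‖B 0 x‖) ≤ |κ| * (‖L 0 x‖ + ‖B 0 x‖) := by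
          gcongr; exact le_abs_self κ
      _ ≤ |κ| * (‖T0 x‖ + ‖T0 x‖) := by gcongr
      _ = _ := by ring
  let e0 : X ≃ₗ[ℂ] Y × (Fin k → ℂ) := LinearEquiv.ofBijective T0.toLinearMap ⟨hinj, hsur⟩
  let e : X ≃L[ℂ] Y × (Fin k → ℂ) := e0.toContinuousLinearEquivOfBounds ‖T0‖ (|κ| * 2)
    (fun x => T0.le_opNorm x) (fun y => by
      obtain ⟨x, rfl⟩ := e0.surjective y
      rw [LinearEquiv.symm_apply_apply]; exact hκ2 x)
  have he : ∀ x, e x = T0 x := fun x => rfl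
  let W := Y × (Fin k → ℂ)
  have : CompleteSpace W :=
    (completeSpace_congr (e := e.toEquiv) e.isUniformEmbedding).1 inferInstance
  let S : W →L[ℂ] X := e.symm
  have hS1 : ∀ w, L 0 (S w) = w.1 := fun w => congrArg Prod.fst (e.apply_symm_apply w)
  have hS2 : ∀ w, B 0 (S w) = w.2 := fun w => congrArg Prod.snd (e.apply_symm_apply w)
  have hS3 : ∀ x, S (L 0 x, B 0 x) = x := fun x => e.symm_apply_apply x
  let inl := ContinuousLinearMap.inl ℂ Y (Fin k → ℂ)
  let inr := ContinuousLinearMap.inr ℂ Y (Fin k → ℂ)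
  let fst := ContinuousLinearMap.fst ℂ Y (Fin k → ℂ)
  let snd := ContinuousLinearMap.snd ℂ Y (Fin k → ℂ)
  let D : ℝ → Y →L[ℂ] (Fin k → ℂ) := fun ε => (B ε - B 0) ∘L S ∘L inl
  let N : ℝ → W →L[ℂ] W := fun ε => inr ∘L D ε ∘L fst
  let E : ℝ → (Fin k → ℂ) →L[ℂ] (Fin k → ℂ) := fun ε => (B ε - B 0) ∘L S ∘L inr
  let G : ℝ → W →L[ℂ] W := fun ε => inl ∘L (L ε - L 0) ∘L S + inr ∘L E ε ∘L snd
  have hE : Tendsto E (𝓝[>] 0) (𝓝 0) := by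
    rw [tendsto_zero_iff_norm_tendsto_zero]
    have h0 : Tendsto (fun ε => ∑ i : Fin k, ‖E ε (Pi.single i 1)‖) (𝓝[>] 0) (𝓝 0) := by
      have h1 : ∀ i : Fin k, Tendsto (fun ε => ‖E ε (Pi.single i 1)‖) (𝓝[>] 0) (𝓝 0) := by
        intro i
        have := (hB (S (inr (Pi.single i 1)))).sub_const (B 0 (S (inr (Pi.single i 1))))
        rw [sub_self] at this
        simpa only [norm_zero] using! this.norm
      have h2 := tendsto_finsetSum Finset.univ (fun i _ => h1 i)
      simpa only [Finset.sum_const_zero] using h2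
    refine squeeze_zero (fun _ => norm_nonneg _) (fun ε => ?_) h0
    refine ContinuousLinearMap.opNorm_le_bound _ (by positivity) fun v => ?_
    have hv : v = ∑ i : Fin k, v i • (Pi.single i (1:ℂ) : Fin k → ℂ) := by
      ext j; simp [Finset.sum_apply, Pi.single_apply]
    conv_lhs => rw [hv, map_sum]
    rw [Finset.sum_mul]
    refine (norm_sum_le _ _).trans (Finset.sum_le_sum fun i _ => ?_)
    rw [map_smul, norm_smul, mul_comm]
    gcongr
    exact norm_le_pi_norm v i
  have hG : Tendsto G (𝓝[>] 0) (𝓝 0) := by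
    have h1 : Tendsto (fun ε => L ε - L 0) (𝓝[>] 0) (𝓝 0) := by
      simpa using hL.sub_const (L 0)
    have c1 : Continuous fun Z : X →L[ℂ] Y => inl ∘L Z ∘L S := by fun_prop
    have c2 : Continuous fun Z : (Fin k → ℂ) →L[ℂ] (Fin k → ℂ) => inr ∘L Z ∘L snd := by fun_prop
    have h2 := (c1.tendsto 0).comp h1
    have h3 := (c2.tendsto 0).comp hE
    have h4 := h2.add h3
    simp only [ContinuousLinearMap.zero_comp, ContinuousLinearMap.comp_zero, add_zero] at h4
    exact h4
  obtain ⟨C, hC0, hN⟩ : ∃ C : ℝ, 0 < C ∧ ∀ᶠ ε in 𝓝[>] (0 : ℝ), ‖1 - N ε‖ ≤ C := by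
    refine ⟨1 + ‖(1 : W →L[ℂ] W)‖ + ‖inr‖ * (((|K| + ‖B 0‖) * (‖S‖ * ‖inl‖)) * ‖fst‖), by positivity, ?_⟩
    filter_upwards [hK] with ε hε
    have : ‖N ε‖ ≤ ‖inr‖ * (((|K| + ‖B 0‖) * (‖S‖ * ‖inl‖)) * ‖fst‖) := by
      refine (ContinuousLinearMap.opNorm_comp_le _ _).trans ?_
      gcongr
      refine (ContinuousLinearMap.opNorm_comp_le _ _).trans ?_
      gcongr
      refine (ContinuousLinearMap.opNorm_comp_le _ _).trans ?_
      gcongr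
      · refine (norm_sub_le _ _).trans ?_
        gcongr
        exact hε.trans (le_abs_self K)
      · exact ContinuousLinearMap.opNorm_comp_le _ _
    have := norm_sub_le (1 : W →L[ℂ] W) (N ε)
    linarith
  have hsmall : ∀ᶠ ε in 𝓝[>] (0 : ℝ), ‖G ε‖ < 1 / (2 * C) := by
    have := (tendsto_zero_iff_norm_tendsto_zero.1 hG)
    exact this.eventually_lt_const (by positivity)
  refine ⟨(‖S‖ + 1) * C * (‖(1 : W →L[ℂ] W)‖ + 1), by positivity, ?_⟩
  filter_upwards [hN, hsmall] with ε hNε hGε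
  have hfac : ∀ w : W, (L ε (S w), B ε (S w)) = (1 + N ε + G ε) w := by
    intro w
    have hw : w = inl w.1 + inr w.2 := by ext <;> simp [inl, inr]
    have h2 : S w = S (inl w.1) + S (inr w.2) := by rw [← map_add, ← hw]
    have hh : (1 + N ε + G ε) w = w + (0, B ε (S (inl w.1)) - B 0 (S (inl w.1))) +
      ((L ε (S w) - L 0 (S w), 0) + (0, B ε (S (inr w.2)) - B 0 (S (inr w.2)))) := rfl
    have h3 : B 0 (S (inl w.1)) = 0 := by rw [hS2]; rfl
    have h4 : B 0 (S (inr w.2)) = w.2 := by rw [hS2]; rfl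
    rw [hh, h3, h4, hS1]
    refine Prod.ext ?_ ?_
    · change L ε (S w) = w.1 + 0 + ((L ε (S w) - w.1) + 0)
      abel
    · change B ε (S w) = w.2 + (B ε (S (inl w.1)) - 0) + (0 + (B ε (S (inr w.2)) - w.2))
      rw [h2, map_add]
      abel
  have hNN : N ε * N ε = 0 := by
    refine ContinuousLinearMap.ext fun w => ?_
    change ((0, D ε 0) : W) = 0
    rw [map_zero]; rfl
  have hlt : ‖-(G ε * (1 - N ε))‖ ≤ 1 / 2 := by
    rw [norm_neg]
    refine (norm_mul_le _ _).trans ?_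
    calc ‖G ε‖ * ‖1 - N ε‖ ≤ 1 / (2 * C) * C := by gcongr
      _ = 1 / 2 := by field_simp
  let t := -(G ε * (1 - N ε))
  let U := Units.oneSub t (hlt.trans_lt (by norm_num))
  have hU : (U : W →L[ℂ] W) = (1 + N ε + G ε) * (1 - N ε) := by
    have : (U : W →L[ℂ] W) = 1 - t := rfl
    rw [this]
    have : (1 + N ε + G ε) * (1 - N ε) = 1 + G ε * (1 - N ε) - N ε * N ε := by
      simp only [mul_sub, add_mul, mul_one, one_mul]; abel
    rw [this, hNN]; simp [t]
  let V : W →L[ℂ] W := (↑U⁻¹ : W →L[ℂ] W)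
  have hVn : ‖V‖ ≤ ‖(1 : W →L[ℂ] W)‖ + 1 := by
    have h1 : V = ∑' n : ℕ, t ^ n := rfl
    rw [h1]
    refine (tsum_geometric_le_of_norm_lt_one t (hlt.trans_lt (by norm_num))).trans ?_
    have : (1 - ‖t‖)⁻¹ ≤ 2 := inv_le_of_inv_le₀ (by simp) (by
      have : ‖t‖ ≤ 1/2 := hlt
      linarith)
    linarith
  have hr : (1 + N ε + G ε) * ((1 - N ε) * V) = 1 := by
    rw [← mul_assoc, ← hU]; exact U.mul_inv
  have hl : ((1 - N ε) * V) * (1 + N ε + G ε) = 1 := by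
    have h1 : (1 - N ε) * (1 + N ε) = 1 := by
      have : (1 - N ε) * (1 + N ε) = 1 - N ε * N ε := by
        simp only [mul_add, sub_mul, mul_one, one_mul]; abel
      rw [this, hNN, sub_zero]
    have h2 : (1 + N ε + G ε) = U * (1 + N ε) := by
      have h3 : (1 - N ε) * (1 + N ε) = 1 := h1
      rw [hU, mul_assoc, h3, mul_one]
    rw [h2, mul_assoc, ← mul_assoc V, show V * (U : W →L[ℂ] W) = 1 from U.inv_mul, one_mul, h1]
  constructor
  · intro f c
    refine ⟨S (((1 - N ε) * V) (f, c)), ?_⟩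
    have := hfac (((1 - N ε) * V) (f, c))
    rw [← mul_apply_eq_comp, hr] at this
    exact ⟨congrArg Prod.fst this, congrArg Prod.snd this⟩
  · intro x
    have h1 := hfac (L 0 x, B 0 x)
    rw [hS3] at h1
    have h2 : ((1 - N ε) * V) (L ε x, B ε x) = (L 0 x, B 0 x) := by
      rw [h1, ← mul_apply_eq_comp, hl]; rfl
    have h3 : x = S (((1 - N ε) * V) (L ε x, B ε x)) := by rw [h2, hS3]
    have h4 : ‖((L ε x, B ε x) : W)‖ ≤ ‖L ε x‖ + ‖B ε x‖ := by
      rw [Prod.norm_def]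
      exact max_le_add_of_nonneg (norm_nonneg _) (norm_nonneg _)
    calc ‖x‖ = ‖S (((1 - N ε) * V) (L ε x, B ε x))‖ := by rw [← h3]
      _ ≤ ‖S‖ * (‖(1 - N ε) * V‖ * ‖((L ε x, B ε x) : W)‖) := by
          refine (S.le_opNorm _).trans ?_
          gcongr
          exact ContinuousLinearMap.le_opNorm _ _
      _ ≤ (‖S‖ + 1) * ((C * (‖(1 : W →L[ℂ] W)‖ + 1)) * (‖L ε x‖ + ‖B ε x‖)) := by
          gcongr
          · linarith
          · refine (norm_mul_le _ _).trans ?_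
            gcongr
      _ = _ := by ring


structure HPar where
  a : ℝ
  b : ℝ
  α : ℝ
  hab : a < b
  h0 : 0 < α
  h1 : α ≤ 1

namespace HPar

abbrev I (P : HPar) : Set ℝ := Set.Icc P.a P.b

def supN (P : HPar) (x : ℝ → ℂ) : ℝ := sSup { s : ℝ | ∃ t ∈ P.I, s = ‖x t‖ }

def semi (P : HPar) (x : ℝ → ℂ) : ℝ :=
  sSup { s : ℝ | ∃ t₁ ∈ P.I, ∃ t₂ ∈ P.I, t₁ < t₂ ∧ s = ‖x t₂ - x t₁‖ / (t₂ - t₁) ^ P.α }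

def nm (P : HPar) : ℕ → (ℝ → ℂ) → ℝ
  | 0, x => P.supN x + P.semi x
  | N + 1, x => P.supN x + nm P N (derivWithin x P.I)

def mm (P : HPar) : ℕ → (ℝ → ℂ) → Prop
  | 0, x => ∃ C : ℝ, ∀ t₁ ∈ P.I, ∀ t₂ ∈ P.I, t₁ < t₂ → ‖x t₂ - x t₁‖ ≤ C * (t₂ - t₁) ^ P.α
  | N + 1, x => DifferentiableOn ℝ x P.I ∧ mm P N (derivWithin x P.I)

variable (P : HPar)

lemma ud : UniqueDiffOn ℝ P.I := uniqueDiffOn_Icc P.hab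

lemma a_mem : P.a ∈ P.I := left_mem_Icc.2 P.hab.le
lemma b_mem : P.b ∈ P.I := right_mem_Icc.2 P.hab.le

lemma rpos {s t : ℝ} (h : s < t) : 0 < (t - s) ^ P.α := Real.rpow_pos_of_pos (by linarith) _

lemma mm0_cont {x : ℝ → ℂ} (h : P.mm 0 x) : ContinuousOn x P.I := by
  obtain ⟨C, hC⟩ := h
  have hsym : ∀ s ∈ P.I, ∀ t ∈ P.I, ‖x t - x s‖ ≤ |C| * |t - s| ^ P.α := by
    intro s hs t ht
    have hle : ∀ u : ℝ, 0 ≤ u → C * u ≤ |C| * u := fun u hu => by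
      gcongr; exact le_abs_self C
    rcases lt_trichotomy s t with h | h | h
    · rw [abs_of_pos (sub_pos.2 h)]
      exact (hC s hs t ht h).trans (hle _ (P.rpos h).le)
    · subst h; simp; positivity
    · rw [norm_sub_rev, abs_sub_comm, abs_of_pos (sub_pos.2 h)]
      exact (hC t ht s hs h).trans (hle _ (P.rpos h).le)
  intro s hs
  refine tendsto_iff_norm_sub_tendsto_zero.2 ?_
  refine squeeze_zero' (Eventually.of_forall fun _ => norm_nonneg _)
    (eventually_of_mem self_mem_nhdsWithin fun t ht => hsym s hs t ht) ?_
  have : Continuous fun t : ℝ => |C| * |t - s| ^ P.α :=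
    continuous_const.mul ((continuous_abs.comp (continuous_id.sub continuous_const)).rpow_const
      (fun _ => Or.inr P.h0.le))
  have h2 := this.tendsto s
  simp only [sub_self, abs_zero, Real.zero_rpow P.h0.ne', mul_zero] at h2
  exact h2.mono_left nhdsWithin_le_nhds

lemma mm_cont {N : ℕ} {x : ℝ → ℂ} (h : P.mm N x) : ContinuousOn x P.I := by
  cases N with
  | zero => exact P.mm0_cont h
  | succ N => exact h.1.continuousOn

lemma supN_bdd {x : ℝ → ℂ} (h : ContinuousOn x P.I) :
    BddAbove { s : ℝ | ∃ t ∈ P.I, s = ‖x t‖ } := by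
  obtain ⟨C, hC⟩ := isCompact_Icc.exists_bound_of_continuousOn h
  exact ⟨C, by rintro _ ⟨t, ht, rfl⟩; exact hC t ht⟩

lemma le_supN {x : ℝ → ℂ} (h : ContinuousOn x P.I) {t : ℝ} (ht : t ∈ P.I) : ‖x t‖ ≤ P.supN x :=
  le_csSup (P.supN_bdd h) ⟨t, ht, rfl⟩

lemma supN_le {x : ℝ → ℂ} {C : ℝ} (h : ∀ t ∈ P.I, ‖x t‖ ≤ C) : P.supN x ≤ C :=
  csSup_le ⟨_, P.a, P.a_mem, rfl⟩ (by rintro _ ⟨t, ht, rfl⟩; exact h t ht)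

lemma supN_nonneg (x : ℝ → ℂ) : 0 ≤ P.supN x :=
  Real.sSup_nonneg (by rintro _ ⟨t, ht, rfl⟩; positivity)

lemma semi_nonneg (x : ℝ → ℂ) : 0 ≤ P.semi x :=
  Real.sSup_nonneg (by
    rintro _ ⟨s, hs, t, ht, h, rfl⟩
    have := P.rpos h
    positivity)

lemma le_semi {x : ℝ → ℂ} (hx : P.mm 0 x) {s t : ℝ} (hs : s ∈ P.I) (ht : t ∈ P.I) (h : s < t) :
    ‖x t - x s‖ ≤ P.semi x * (t - s) ^ P.α := by
  rw [← div_le_iff₀ (P.rpos h)]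
  obtain ⟨C, hC⟩ := hx
  refine le_csSup ⟨C, ?_⟩ ⟨s, hs, t, ht, h, rfl⟩
  rintro _ ⟨s, hs, t, ht, h, rfl⟩
  rw [div_le_iff₀ (P.rpos h)]
  exact hC s hs t ht h

lemma semi_le {x : ℝ → ℂ} {C : ℝ}
    (h : ∀ s ∈ P.I, ∀ t ∈ P.I, s < t → ‖x t - x s‖ ≤ C * (t - s) ^ P.α) : P.semi x ≤ C := by
  refine csSup_le ⟨_, P.a, P.a_mem, P.b, P.b_mem, P.hab, rfl⟩ ?_
  rintro _ ⟨s, hs, t, ht, hst, rfl⟩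
  rw [div_le_iff₀ (P.rpos hst)]
  exact h s hs t ht hst

lemma nm_nonneg (N : ℕ) (x : ℝ → ℂ) : 0 ≤ P.nm N x := by
  induction N generalizing x with
  | zero => exact add_nonneg (P.supN_nonneg x) (P.semi_nonneg x)
  | succ N ih => exact add_nonneg (P.supN_nonneg x) (ih _)

lemma supN_le_nm (N : ℕ) (x : ℝ → ℂ) : P.supN x ≤ P.nm N x := by
  cases N with
  | zero => exact le_add_of_nonneg_right (P.semi_nonneg x)
  | succ N => exact le_add_of_nonneg_right (P.nm_nonneg _ _)

lemma supN_congr {x y : ℝ → ℂ} (h : EqOn x y P.I) : P.supN x = P.supN y := by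
  unfold supN
  congr 1; ext s
  constructor
  · rintro ⟨t, ht, rfl⟩; exact ⟨t, ht, by rw [h ht]⟩
  · rintro ⟨t, ht, rfl⟩; exact ⟨t, ht, by rw [h ht]⟩

lemma semi_congr {x y : ℝ → ℂ} (h : EqOn x y P.I) : P.semi x = P.semi y := by
  unfold semi
  congr 1; ext s
  constructor
  · rintro ⟨t, ht, u, hu, htu, rfl⟩; exact ⟨t, ht, u, hu, htu, by rw [h ht, h hu]⟩
  · rintro ⟨t, ht, u, hu, htu, rfl⟩; exact ⟨t, ht, u, hu, htu, by rw [h ht, h hu]⟩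

lemma d_congr {x y : ℝ → ℂ} (h : EqOn x y P.I) :
    EqOn (derivWithin x P.I) (derivWithin y P.I) P.I := fun _ ht => derivWithin_congr h (h ht)

lemma nm_congr {N : ℕ} {x y : ℝ → ℂ} (h : EqOn x y P.I) : P.nm N x = P.nm N y := by
  induction N generalizing x y with
  | zero => simp only [nm, P.supN_congr h, P.semi_congr h]
  | succ N ih => simp only [nm, P.supN_congr h, ih (P.d_congr h)]

lemma mm_congr {N : ℕ} {x y : ℝ → ℂ} (h : EqOn x y P.I) (hx : P.mm N x) : P.mm N y := by
  induction N generalizing x y with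
  | zero =>
    obtain ⟨C, hC⟩ := hx
    exact ⟨C, fun s hs t ht => by rw [← h hs, ← h ht]; exact hC s hs t ht⟩
  | succ N ih => exact ⟨hx.1.congr fun t ht => (h ht).symm, ih (P.d_congr h) hx.2⟩

/-! comparison with the frozen definitions -/

lemma holMem_iff (N : ℕ) (x : ℝ → ℂ) : HolMem P.a P.b N P.α x ↔ P.mm N x := by
  induction N generalizing x with
  | zero =>
    simp only [HolMem, mm, iteratedDerivWithin_zero]
    refine ⟨fun h => h.2, fun h => ⟨?_, h⟩⟩
    exact contDiffOn_zero.2 (P.mm0_cont h)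
  | succ N ih =>
    rw [mm, ← ih]
    unfold HolMem
    rw [iteratedDerivWithin_succ']
    have := contDiffOn_succ_iff_derivWithin (n := (N : WithTop ℕ∞)) (f := x) P.ud
    push_cast
    rw [this]
    simp [and_assoc]

lemma holNorm_eq (N : ℕ) (x : ℝ → ℂ) : holNorm P.a P.b N P.α x = P.nm N x := by
  induction N generalizing x with
  | zero => simp [holNorm, holSemiNorm, nm, supN, semi]
  | succ N ih =>
    rw [nm, ← ih]
    unfold holNorm holSemiNorm
    rw [Finset.sum_range_succ']
    simp only [iteratedDerivWithin_succ', iteratedDerivWithin_zero]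
    unfold supN
    ring

/-! linear structure -/

lemma mm_add {N : ℕ} {x y : ℝ → ℂ} (hx : P.mm N x) (hy : P.mm N y) :
    P.mm N (x + y) ∧ P.nm N (x + y) ≤ P.nm N x + P.nm N y := by
  have hs : P.supN (x + y) ≤ P.supN x + P.supN y := P.supN_le fun t ht =>
    (norm_add_le _ _).trans (add_le_add (P.le_supN (P.mm_cont hx) ht) (P.le_supN (P.mm_cont hy) ht))
  induction N generalizing x y with
  | zero =>
    have key : ∀ s ∈ P.I, ∀ t ∈ P.I, s < t →
        ‖(x + y) t - (x + y) s‖ ≤ (P.semi x + P.semi y) * (t - s) ^ P.α := by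
      intro s hs t ht h
      rw [add_mul, Pi.add_apply, Pi.add_apply, add_sub_add_comm]
      exact (norm_add_le _ _).trans (add_le_add (P.le_semi hx hs ht h) (P.le_semi hy hs ht h))
    refine ⟨⟨_, key⟩, ?_⟩
    have := P.semi_le key
    simp only [nm]; linarith
  | succ N ih =>
    have hd : EqOn (derivWithin x P.I + derivWithin y P.I) (derivWithin (x + y) P.I) P.I :=
      fun t ht => (derivWithin_add (hx.1 t ht) (hy.1 t ht)).symm
    have h := ih hx.2 hy.2 (P.supN_le fun t ht =>
      (norm_add_le _ _).trans (add_le_add (P.le_supN (P.mm_cont hx.2) ht)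
        (P.le_supN (P.mm_cont hy.2) ht)))
    refine ⟨⟨hx.1.add hy.1, P.mm_congr hd h.1⟩, ?_⟩
    have h2 := h.2
    rw [P.nm_congr hd] at h2
    simp only [nm]; linarith

lemma mm_smul {N : ℕ} {x : ℝ → ℂ} (c : ℂ) (hx : P.mm N x) :
    P.mm N (c • x) ∧ P.nm N (c • x) ≤ ‖c‖ * P.nm N x := by
  induction N generalizing x with
  | zero =>
    have hs : P.supN (c • x) ≤ ‖c‖ * P.supN x := P.supN_le fun t ht => by
      rw [Pi.smul_apply, norm_smul]
      gcongr
      exact P.le_supN (P.mm_cont hx) ht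
    have key : ∀ s ∈ P.I, ∀ t ∈ P.I, s < t →
        ‖(c • x) t - (c • x) s‖ ≤ (‖c‖ * P.semi x) * (t - s) ^ P.α := by
      intro s hs t ht h
      rw [Pi.smul_apply, Pi.smul_apply, ← smul_sub, norm_smul, mul_assoc]
      gcongr
      exact P.le_semi hx hs ht h
    refine ⟨⟨_, key⟩, ?_⟩
    have := P.semi_le key
    simp only [nm]; linarith
  | succ N ih =>
    have hs : P.supN (c • x) ≤ ‖c‖ * P.supN x := P.supN_le fun t ht => by
      rw [Pi.smul_apply, norm_smul]
      gcongr
      exact P.le_supN (P.mm_cont hx) ht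
    have hd : EqOn (c • derivWithin x P.I) (derivWithin (c • x) P.I) P.I :=
      fun t ht => (derivWithin_const_smul c (hx.1 t ht)).symm
    have h := ih hx.2
    refine ⟨⟨hx.1.const_smul c, P.mm_congr hd h.1⟩, ?_⟩
    have h2 := h.2
    rw [P.nm_congr hd] at h2
    simp only [nm]; linarith

lemma mm_const (N : ℕ) (c : ℂ) : P.mm N (fun _ => c) := by
  induction N generalizing c with
  | zero => exact ⟨0, fun s _ t _ _ => by simp⟩
  | succ N ih =>
    refine ⟨differentiableOn_const c, P.mm_congr (fun t ht => ?_) (ih 0)⟩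
    simp

lemma mm_zero (N : ℕ) : P.mm N 0 := P.mm_const N 0

lemma nm_zero (N : ℕ) : P.nm N 0 = 0 := by
  have := (P.mm_smul 0 (P.mm_zero N)).2
  rw [zero_smul, norm_zero, zero_mul] at this
  exact le_antisymm this (P.nm_nonneg _ _)

lemma mm_sub {N : ℕ} {x y : ℝ → ℂ} (hx : P.mm N x) (hy : P.mm N y) : P.mm N (x - y) := by
  have h := (P.mm_add hx (P.mm_smul (-1) hy).1).1
  rwa [neg_one_smul, ← sub_eq_add_neg] at h

/-! mean value -/

lemma mvt {x : ℝ → ℂ} (hx : DifferentiableOn ℝ x P.I) {C : ℝ}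
    (hC : ∀ t ∈ P.I, ‖derivWithin x P.I t‖ ≤ C) {s t : ℝ} (hs : s ∈ P.I) (ht : t ∈ P.I) :
    ‖x t - x s‖ ≤ C * |t - s| := by
  have := (convex_Icc P.a P.b).norm_image_sub_le_of_norm_derivWithin_le hx hC hs ht
  simpa using this

lemma lip_hol {s t C : ℝ} (hC : 0 ≤ C) (hs : s ∈ P.I) (ht : t ∈ P.I) (h : s < t) :
    C * |t - s| ≤ (C * (P.b - P.a) ^ (1 - P.α)) * (t - s) ^ P.α := by
  have hp : 0 < t - s := sub_pos.2 h
  rw [abs_of_pos hp, mul_assoc]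
  gcongr
  calc t - s = (t - s) ^ (1 - P.α) * (t - s) ^ P.α := by
        rw [← Real.rpow_add hp]; simp
    _ ≤ _ := by
        gcongr
        · linarith [P.h1]
        · exact ht.2
        · exact hs.1

lemma incl1 (N : ℕ) : ∃ C : ℝ, 0 ≤ C ∧ ∀ x, P.mm (N + 1) x →
    P.mm N x ∧ P.nm N x ≤ C * P.nm (N + 1) x := by
  induction N with
  | zero =>
    have hbα : 0 ≤ (P.b - P.a) ^ (1 - P.α) := Real.rpow_nonneg (by linarith [P.hab]) _
    refine ⟨1 + (P.b - P.a) ^ (1 - P.α), by positivity, fun x hx => ?_⟩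
    have hc := P.mm_cont hx.2
    have key : ∀ s ∈ P.I, ∀ t ∈ P.I, s < t →
        ‖x t - x s‖ ≤ (P.supN (derivWithin x P.I) * (P.b - P.a) ^ (1 - P.α)) * (t - s) ^ P.α :=
      fun s hs t ht h => (P.mvt hx.1 (fun t ht => P.le_supN hc ht) hs ht).trans
        (P.lip_hol (P.supN_nonneg _) hs ht h)
    refine ⟨⟨_, key⟩, ?_⟩
    have h1 := P.semi_le key
    have h2 := P.supN_le_nm 0 (derivWithin x P.I)
    have h3 := P.supN_nonneg x
    have h4 := P.supN_nonneg (derivWithin x P.I)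
    have h5 := mul_le_mul_of_nonneg_right h2 hbα
    have h6 := mul_nonneg h3 hbα
    have e1 : P.nm 0 x = P.supN x + P.semi x := rfl
    have e2 : P.nm (0 + 1) x = P.supN x + P.nm 0 (derivWithin x P.I) := rfl
    rw [e1, e2]
    nlinarith
  | succ N ih =>
    obtain ⟨C, hC, h⟩ := ih
    refine ⟨1 + C, by positivity, fun x hx => ?_⟩
    have h1 := h _ hx.2
    refine ⟨⟨hx.1, h1.1⟩, ?_⟩
    have h2 := h1.2
    have h3 := P.supN_nonneg x
    have h4 := P.nm_nonneg (N + 1) (derivWithin x P.I)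
    have e1 : P.nm (N + 1) x = P.supN x + P.nm N (derivWithin x P.I) := rfl
    have e2 : P.nm (N + 1 + 1) x = P.supN x + P.nm (N + 1) (derivWithin x P.I) := rfl
    rw [e1, e2]
    nlinarith [mul_nonneg hC h3]

lemma incl (N k : ℕ) : ∃ C : ℝ, 0 ≤ C ∧ ∀ x, P.mm (N + k) x →
    P.mm N x ∧ P.nm N x ≤ C * P.nm (N + k) x := by
  induction k with
  | zero => exact ⟨1, zero_le_one, fun x hx => ⟨hx, by simp⟩⟩
  | succ k ih =>
    obtain ⟨C, hC, h⟩ := ih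
    obtain ⟨D, hD, h'⟩ := P.incl1 (N + k)
    refine ⟨C * D, by positivity, fun x hx => ?_⟩
    have h1 := h' x hx
    refine ⟨(h x h1.1).1, (h x h1.1).2.trans ?_⟩
    rw [mul_assoc]
    gcongr
    exact h1.2

lemma ideriv (N j : ℕ) (x : ℝ → ℂ) (hx : P.mm (N + j) x) :
    P.mm N (iteratedDerivWithin j x P.I) ∧
      P.nm N (iteratedDerivWithin j x P.I) ≤ P.nm (N + j) x := by
  induction j generalizing x with
  | zero => simpa using hx
  | succ j ih =>
    have h := ih _ hx.2
    rw [iteratedDerivWithin_succ']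
    exact ⟨h.1, h.2.trans (le_add_of_nonneg_left (P.supN_nonneg x))⟩

lemma ideriv' (n r j : ℕ) (hj : j ≤ r) : ∃ C : ℝ, 0 ≤ C ∧ ∀ x, P.mm (n + r) x →
    P.mm n (iteratedDerivWithin j x P.I) ∧
      P.nm n (iteratedDerivWithin j x P.I) ≤ C * P.nm (n + r) x := by
  obtain ⟨C, hC, h⟩ := P.incl n (r - j)
  refine ⟨C, hC, fun x hx => ?_⟩
  have e : n + r = n + (r - j) + j := by omega
  rw [e] at hx ⊢
  have h1 := P.ideriv _ _ x hx
  have h2 := h _ h1.1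
  exact ⟨h2.1, h2.2.trans (by gcongr; exact h1.2)⟩

lemma mm_mul (N : ℕ) : ∃ C : ℝ, 0 ≤ C ∧ ∀ x y, P.mm N x → P.mm N y →
    P.mm N (x * y) ∧ P.nm N (x * y) ≤ C * (P.nm N x * P.nm N y) := by
  have hs : ∀ N x y, P.mm N x → P.mm N y → P.supN (x * y) ≤ P.supN x * P.supN y :=
    fun N x y hx hy => P.supN_le fun t ht => by
      rw [Pi.mul_apply, norm_mul]
      exact mul_le_mul (P.le_supN (P.mm_cont hx) ht) (P.le_supN (P.mm_cont hy) ht)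
        (norm_nonneg _) (P.supN_nonneg _)
  induction N with
  | zero =>
    refine ⟨1, zero_le_one, fun x y hx hy => ?_⟩
    have key : ∀ s ∈ P.I, ∀ t ∈ P.I, s < t →
        ‖(x * y) t - (x * y) s‖ ≤ (P.supN x * P.semi y + P.semi x * P.supN y) * (t - s) ^ P.α := by
      intro s hs t ht h
      have e : (x * y) t - (x * y) s = x t * (y t - y s) + (x t - x s) * y s := by
        simp only [Pi.mul_apply]; ring
      rw [e]
      refine (norm_add_le _ _).trans ?_
      rw [norm_mul, norm_mul]
      have h1 := mul_le_mul (P.le_supN (P.mm_cont hx) ht) (P.le_semi hy hs ht h)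
        (norm_nonneg _) (P.supN_nonneg _)
      have h2 := mul_le_mul (P.le_semi hx hs ht h) (P.le_supN (P.mm_cont hy) hs)
        (norm_nonneg _) (mul_nonneg (P.semi_nonneg _) (P.rpos h).le)
      linarith
    refine ⟨⟨_, key⟩, ?_⟩
    have h1 := P.semi_le key
    have h2 := hs 0 x y hx hy
    have h3 := mul_nonneg (P.semi_nonneg x) (P.semi_nonneg y)
    simp only [nm]
    linarith
  | succ N ih =>
    obtain ⟨C, hC, h⟩ := ih
    obtain ⟨D, hD, h'⟩ := P.incl1 N
    refine ⟨1 + 2 * C * D, by positivity, fun x y hx hy => ?_⟩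
    have hx' := h' x hx
    have hy' := h' y hy
    have m1 := h _ _ hx.2 hy'.1
    have m2 := h _ _ hx'.1 hy.2
    have m3 := P.mm_add m1.1 m2.1
    have hd : EqOn (derivWithin x P.I * y + x * derivWithin y P.I) (derivWithin (x * y) P.I) P.I :=
      fun t ht => (derivWithin_mul (hx.1 t ht) (hy.1 t ht)).symm
    refine ⟨⟨hx.1.mul hy.1, P.mm_congr hd m3.1⟩, ?_⟩
    have h3 := m3.2
    rw [P.nm_congr hd] at h3
    have e1 : P.nm (N + 1) x = P.supN x + P.nm N (derivWithin x P.I) := rfl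
    have e2 : P.nm (N + 1) y = P.supN y + P.nm N (derivWithin y P.I) := rfl
    have e3 : P.nm (N + 1) (x * y) = P.supN (x * y) + P.nm N (derivWithin (x * y) P.I) := rfl
    have i1 : P.nm N (derivWithin x P.I) ≤ P.nm (N + 1) x := by
      rw [e1]; linarith [P.supN_nonneg x]
    have i2 : P.nm N (derivWithin y P.I) ≤ P.nm (N + 1) y := by
      rw [e2]; linarith [P.supN_nonneg y]
    have px := P.nm_nonneg (N + 1) x
    have py := P.nm_nonneg (N + 1) y
    have j1 : C * (P.nm N (derivWithin x P.I) * P.nm N y) ≤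
        C * (P.nm (N + 1) x * (D * P.nm (N + 1) y)) := by
      gcongr
      · exact P.nm_nonneg _ _
      · exact hy'.2
    have j2 : C * (P.nm N x * P.nm N (derivWithin y P.I)) ≤
        C * ((D * P.nm (N + 1) x) * P.nm (N + 1) y) := by
      gcongr
      · exact P.nm_nonneg _ _
      · exact hx'.2
    have j3 : P.supN (x * y) ≤ P.nm (N + 1) x * P.nm (N + 1) y :=
      (hs _ x y hx hy).trans (mul_le_mul (P.supN_le_nm _ _) (P.supN_le_nm _ _)
        (P.supN_nonneg _) px)
    rw [e3]
    have := m1.2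
    have := m2.2
    nlinarith


/-! completeness -/

lemma complete_aux (N : ℕ) (x : ℕ → ℝ → ℂ) (hx : ∀ k, P.mm N (x k))
    (hc : ∀ e > 0, ∃ K, ∀ k ≥ K, ∀ l ≥ K, P.nm N (x k - x l) ≤ e) :
    ∃ y, P.mm N y ∧ Tendsto (fun k => P.nm N (x k - y)) atTop (𝓝 0) := by
  have hpt : ∀ N (x : ℕ → ℝ → ℂ), (∀ k, P.mm N (x k)) →
      (∀ e > 0, ∃ K, ∀ k ≥ K, ∀ l ≥ K, P.nm N (x k - x l) ≤ e) →
      ∀ t ∈ P.I, ∃ z, Tendsto (fun k => x k t) atTop (𝓝 z) := by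
    intro N x hx hc t ht
    refine cauchySeq_tendsto_of_complete (Metric.cauchySeq_iff.2 fun e he => ?_)
    obtain ⟨K, hK⟩ := hc (e / 2) (by positivity)
    refine ⟨K, fun k hk l hl => ?_⟩
    rw [dist_eq_norm]
    have h1 := P.le_supN (P.mm_cont (P.mm_sub (hx k) (hx l))) ht
    have h2 := P.supN_le_nm N (x k - x l)
    have h3 := hK k hk l hl
    simp only [Pi.sub_apply] at h1
    linarith
  have hconv : ∀ (u : ℕ → ℝ), (∀ k, 0 ≤ u k) → (∀ e > 0, ∃ K, ∀ k ≥ K, u k ≤ e) →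
      Tendsto u atTop (𝓝 0) := by
    intro u hu h
    refine Metric.tendsto_atTop.2 fun e he => ?_
    obtain ⟨K, hK⟩ := h (e / 2) (by positivity)
    refine ⟨K, fun k hk => ?_⟩
    rw [Real.dist_eq, sub_zero, abs_of_nonneg (hu k)]
    linarith [hK k hk]
  induction N generalizing x with
  | zero =>
    choose! y hy using hpt 0 x hx hc
    have hsup : ∀ e, ∀ K, (∀ k ≥ K, ∀ l ≥ K, P.nm 0 (x k - x l) ≤ e) → ∀ k ≥ K,
        P.supN (x k - y) ≤ e := by
      intro e K hK k hk
      refine P.supN_le fun t ht => ?_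
      refine le_of_tendsto ((hy t ht).const_sub (x k t)).norm ?_
      filter_upwards [eventually_ge_atTop K] with l hl
      exact (P.le_supN (P.mm_cont (P.mm_sub (hx k) (hx l))) ht).trans
        ((P.supN_le_nm 0 _).trans (hK k hk l hl))
    have hsemi : ∀ e, ∀ K, (∀ k ≥ K, ∀ l ≥ K, P.nm 0 (x k - x l) ≤ e) → ∀ k ≥ K,
        ∀ s ∈ P.I, ∀ t ∈ P.I, s < t → ‖(x k - y) t - (x k - y) s‖ ≤ e * (t - s) ^ P.α := by
      intro e K hK k hk s hs t ht hst
      refine le_of_tendsto (((hy t ht).const_sub (x k t)).sub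
        ((hy s hs).const_sub (x k s))).norm ?_
      filter_upwards [eventually_ge_atTop K] with l hl
      refine (P.le_semi (P.mm_sub (hx k) (hx l)) hs ht hst).trans ?_
      have := P.rpos hst
      gcongr
      exact (le_add_of_nonneg_left (P.supN_nonneg _)).trans (hK k hk l hl)
    have hy0 : P.mm 0 y := by
      obtain ⟨K, hK⟩ := hc 1 one_pos
      have h1 : P.mm 0 (x K - y) := ⟨1, hsemi 1 K hK K le_rfl⟩
      have h2 := P.mm_sub (hx K) h1
      rwa [sub_sub_cancel] at h2
    refine ⟨y, hy0, hconv _ (fun k => P.nm_nonneg _ _) fun e he => ?_⟩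
    obtain ⟨K, hK⟩ := hc (e / 2) (by positivity)
    refine ⟨K, fun k hk => ?_⟩
    have h1 := hsup _ K hK k hk
    have h2 := P.semi_le (hsemi _ K hK k hk)
    simp only [nm]; linarith
  | succ N ih =>
    have hd : ∀ k l, EqOn (derivWithin (x k - x l) P.I)
        (derivWithin (x k) P.I - derivWithin (x l) P.I) P.I :=
      fun k l t ht => derivWithin_sub ((hx k).1 t ht) ((hx l).1 t ht)
    obtain ⟨g, hg, hlim⟩ := ih (fun k => derivWithin (x k) P.I) (fun k => (hx k).2) (by
      intro e he
      obtain ⟨K, hK⟩ := hc e he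
      refine ⟨K, fun k hk l hl => le_trans ?_ (hK k hk l hl)⟩
      rw [← P.nm_congr (hd k l)]
      exact le_add_of_nonneg_left (P.supN_nonneg _))
    obtain ⟨z, hz⟩ := hpt (N + 1) x hx hc P.a P.a_mem
    have hgc : ContinuousOn g P.I := P.mm_cont hg
    let y : ℝ → ℂ := fun t => z + ∫ s in P.a..t, g s
    have hya : y P.a = z := by simp [y]
    have hyd : ∀ t ∈ P.I, HasDerivWithinAt y (g t) P.I t := by
      intro t ht
      have : Fact (t ∈ Icc P.a P.b) := ⟨ht⟩
      refine HasDerivWithinAt.const_add _ ?_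
      refine intervalIntegral.integral_hasDerivWithinAt_right ?_ ?_ (hgc t ht)
      · refine ContinuousOn.intervalIntegrable (hgc.mono ?_)
        rw [uIcc_of_le ht.1]
        exact Icc_subset_Icc_right ht.2
      · exact hgc.stronglyMeasurableAtFilter_nhdsWithin measurableSet_Icc t
    have hyD : EqOn g (derivWithin y P.I) P.I :=
      fun t ht => ((hyd t ht).derivWithin (P.ud t ht)).symm
    have hym : P.mm (N + 1) y :=
      ⟨fun t ht => (hyd t ht).differentiableWithinAt, P.mm_congr hyD hg⟩
    refine ⟨y, hym, ?_⟩
    have hd2 : ∀ k, EqOn (derivWithin (x k) P.I - g) (derivWithin (x k - y) P.I) P.I :=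
      fun k t ht => by
        rw [derivWithin_sub ((hx k).1 t ht) (hym.1 t ht), ← hyD ht]; rfl
    have hbd : ∀ k, P.nm (N + 1) (x k - y) ≤ ‖x k P.a - z‖ +
        (1 + (P.b - P.a)) * P.nm N (derivWithin (x k) P.I - g) := by
      intro k
      have e1 : P.nm (N + 1) (x k - y) = P.supN (x k - y) + P.nm N (derivWithin (x k - y) P.I) := rfl
      rw [e1, ← P.nm_congr (hd2 k)]
      have hm := P.mm_sub (hx k) hym
      have hm2 := P.mm_sub (hx k).2 hg
      have : P.supN (x k - y) ≤ ‖x k P.a - z‖ +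
          (P.b - P.a) * P.nm N (derivWithin (x k) P.I - g) := by
        refine P.supN_le fun t ht => ?_
        have h1 := P.mvt hm.1 (C := P.nm N (derivWithin (x k) P.I - g)) (fun t ht => by
          rw [← hd2 k ht]
          exact (P.le_supN (P.mm_cont hm2) ht).trans (P.supN_le_nm _ _)) P.a_mem ht
        have h2 : |t - P.a| ≤ P.b - P.a := by
          rw [abs_of_nonneg (by linarith [ht.1])]; linarith [ht.2]
        have h3 := mul_le_mul_of_nonneg_left h2 (P.nm_nonneg N (derivWithin (x k) P.I - g))
        have h4 : (x k - y) P.a = x k P.a - z := by rw [Pi.sub_apply, hya]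
        have h5 := norm_add_le ((x k - y) t - (x k - y) P.a) ((x k - y) P.a)
        rw [sub_add_cancel, h4] at h5
        rw [h4] at h1
        linarith
      linarith
    refine squeeze_zero (fun k => P.nm_nonneg _ _) hbd ?_
    have h1 := (hz.sub_const z).norm
    have h2 := hlim.const_mul (1 + (P.b - P.a))
    simpa using h1.add h2

/-! monomials -/

def mono (j : ℕ) : ℝ → ℂ := fun t => ((t ^ j / (j.factorial : ℝ) : ℝ) : ℂ)

lemma mono_zero : mono 0 = fun _ => 1 := by ext; simp [mono]

lemma mono_deriv (j : ℕ) (t : ℝ) : HasDerivAt (mono (j + 1)) (mono j t) t := by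
  have h := ((hasDerivAt_pow (j + 1) t).div_const ((j + 1).factorial : ℝ)).ofReal_comp
  refine h.congr_deriv ?_
  unfold mono
  congr 1
  rw [Nat.factorial_succ]
  have : (j.factorial : ℝ) ≠ 0 := by positivity
  push_cast
  field_simp

lemma mono_dw (j : ℕ) : EqOn (derivWithin (mono (j + 1)) P.I) (mono j) P.I :=
  fun t ht => (mono_deriv j t).hasDerivWithinAt.derivWithin (P.ud t ht)

lemma mm_mono (N j : ℕ) : P.mm N (mono j) := by
  induction j generalizing N with
  | zero => rw [mono_zero]; exact P.mm_const N 1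
  | succ j ih =>
    obtain ⟨C, _, h⟩ := P.incl1 N
    exact (h _ ⟨fun t _ => (mono_deriv j t).differentiableAt.differentiableWithinAt,
      P.mm_congr (P.mono_dw j).symm (ih N)⟩).1

lemma mono_id (j i : ℕ) :
    EqOn (iteratedDerivWithin (j + i) (mono j) P.I) (if i = 0 then 1 else 0) P.I := by
  induction j with
  | zero =>
    intro t ht
    rw [mono_zero, zero_add, iteratedDerivWithin_const]
    split_ifs <;> rfl
  | succ j ih =>
    intro t ht
    rw [show j + 1 + i = (j + i) + 1 by ring, iteratedDerivWithin_succ']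
    rw [iteratedDerivWithin_congr (P.mono_dw j) ht]
    exact ih ht

/-! the Banach space -/

def HS (N : ℕ) : Submodule ℂ (ℝ → ℂ) where
  carrier := {x | P.mm N x ∧ ∀ t, t ∉ P.I → x t = 0}
  add_mem' := fun hx hy => ⟨(P.mm_add hx.1 hy.1).1, fun t ht => by
    rw [Pi.add_apply, hx.2 t ht, hy.2 t ht, add_zero]⟩
  zero_mem' := ⟨P.mm_zero N, fun _ _ => rfl⟩
  smul_mem' := fun c x hx => ⟨(P.mm_smul c hx.1).1, fun t ht => by
    rw [Pi.smul_apply, hx.2 t ht, smul_zero]⟩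

def H (N : ℕ) : Type := P.HS N

instance (N : ℕ) : AddCommGroup (P.H N) := inferInstanceAs (AddCommGroup (P.HS N))
instance (N : ℕ) : Module ℂ (P.H N) := inferInstanceAs (Module ℂ (P.HS N))

def H.fn {P : HPar} {N : ℕ} (x : P.H N) : ℝ → ℂ := x.1

lemma H.mem {P : HPar} {N : ℕ} (x : P.H N) : P.mm N x.fn := x.2.1

@[simp] lemma H.fn_add {P : HPar} {N : ℕ} (x y : P.H N) : (x + y).fn = x.fn + y.fn := rfl
@[simp] lemma H.fn_smul {P : HPar} {N : ℕ} (c : ℂ) (x : P.H N) : (c • x).fn = c • x.fn := rfl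
@[simp] lemma H.fn_zero {P : HPar} {N : ℕ} : (0 : P.H N).fn = 0 := rfl
@[simp] lemma H.fn_sub {P : HPar} {N : ℕ} (x y : P.H N) : (x - y).fn = x.fn - y.fn := rfl

lemma H.ext' {P : HPar} {N : ℕ} {x y : P.H N} (h : EqOn x.fn y.fn P.I) : x = y := by
  apply Subtype.ext
  funext t
  by_cases ht : t ∈ P.I
  · exact h ht
  · rw [x.2.2 t ht, y.2.2 t ht]

open Classical in
/-- restriction of a function to an element of `H N` (zero if not Hölder). -/
def toH (N : ℕ) (x : ℝ → ℂ) : P.H N :=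
  if h : P.mm N x then ⟨P.I.indicator x, P.mm_congr (fun _ ht => (indicator_of_mem ht x).symm) h,
    fun _ ht => indicator_of_notMem ht x⟩ else 0

lemma toH_fn {N : ℕ} {x : ℝ → ℂ} (h : P.mm N x) : EqOn (P.toH N x).fn x P.I := by
  intro t ht
  exact (congrArg (fun z : P.H N => z.fn t) (dif_pos h)).trans (indicator_of_mem ht x)

instance (N : ℕ) : Norm (P.H N) := ⟨fun x => P.nm N x.fn⟩

lemma norm_def' {N : ℕ} (x : P.H N) : ‖x‖ = P.nm N x.fn := rfl

lemma core (N : ℕ) : NormedSpace.Core ℂ (P.H N) where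
  norm_nonneg x := P.nm_nonneg _ _
  norm_smul c x := by
    refine le_antisymm (P.mm_smul c x.mem).2 ?_
    by_cases hc : c = 0
    · subst hc; rw [norm_zero, zero_mul]; exact P.nm_nonneg _ _
    · have h := (P.mm_smul c⁻¹ (c • x).mem).2
      rw [H.fn_smul, inv_smul_smul₀ hc, norm_inv] at h
      have hp : 0 < ‖c‖ := norm_pos_iff.2 hc
      rw [inv_mul_eq_div, le_div_iff₀ hp, mul_comm] at h
      exact h
  norm_triangle x y := (P.mm_add x.mem y.mem).2
  norm_eq_zero_iff x := by
    constructor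
    · intro h
      refine H.ext' fun t ht => ?_
      have h1 := P.le_supN (P.mm_cont x.mem) ht
      have h2 := P.supN_le_nm N x.fn
      have h3 : P.nm N x.fn = 0 := h
      exact norm_le_zero_iff.1 (by linarith)
    · rintro rfl; exact P.nm_zero N

instance (N : ℕ) : NormedAddCommGroup (P.H N) := NormedAddCommGroup.ofCore (P.core N)
instance (N : ℕ) : NormedSpace ℂ (P.H N) := NormedSpace.ofCore (P.core N)

lemma norm_eq {N : ℕ} (x : P.H N) : ‖x‖ = P.nm N x.fn := rfl

instance (N : ℕ) : CompleteSpace (P.H N) := by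
  refine Metric.complete_of_cauchySeq_tendsto fun u hu => ?_
  obtain ⟨y, hy, hlim⟩ := P.complete_aux N (fun k => (u k).fn) (fun k => (u k).mem) (by
    intro e he
    obtain ⟨K, hK⟩ := Metric.cauchySeq_iff.1 hu e he
    refine ⟨K, fun k hk l hl => ?_⟩
    have := hK k hk l hl
    rw [dist_eq_norm, norm_eq, H.fn_sub] at this
    exact this.le)
  refine ⟨P.toH N y, tendsto_iff_norm_sub_tendsto_zero.2 ?_⟩
  refine hlim.congr fun k => ?_
  rw [norm_eq, H.fn_sub]
  exact P.nm_congr fun t ht => by rw [Pi.sub_apply, Pi.sub_apply, P.toH_fn hy ht]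

lemma norm_toH {N : ℕ} {x : ℝ → ℂ} (h : P.mm N x) : ‖P.toH N x‖ = P.nm N x := by
  rw [norm_eq, P.nm_congr (P.toH_fn h)]

/-- the derivative of order `j ≤ r` -/
lemma exD (n r j : ℕ) (hj : j ≤ r) : ∃ D : P.H (n + r) →L[ℂ] P.H n,
    ∀ x, EqOn (D x).fn (iteratedDerivWithin j x.fn P.I) P.I := by
  obtain ⟨C, hC, h⟩ := P.ideriv' n r j hj
  have hm : ∀ x : P.H (n + r), P.mm n (iteratedDerivWithin j x.fn P.I) := fun x => (h _ x.mem).1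
  have hcd : ∀ x : P.H (n + r), ContDiffOn ℝ j x.fn P.I := fun x =>
    ((P.holMem_iff _ _).2 x.mem).1.of_le (by exact_mod_cast (by omega : j ≤ n + r))
  let D0 : P.H (n + r) →ₗ[ℂ] P.H n :=
    { toFun := fun x => P.toH n (iteratedDerivWithin j x.fn P.I)
      map_add' := fun x y => H.ext' fun t ht =>
        (P.toH_fn (hm (x + y)) ht).trans
          ((iteratedDerivWithin_add ht P.ud (hcd x t ht) (hcd y t ht)).trans
            (congrArg₂ (· + ·) (P.toH_fn (hm x) ht) (P.toH_fn (hm y) ht)).symm)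
      map_smul' := fun c x => H.ext' fun t ht =>
        (P.toH_fn (hm (c • x)) ht).trans
          ((iteratedDerivWithin_const_smul ht P.ud c (hcd x t ht)).trans
            (congrArg (c • ·) (P.toH_fn (hm x) ht)).symm) }
  refine ⟨D0.mkContinuous C fun x => ?_, fun x => P.toH_fn (hm x)⟩
  change ‖P.toH n _‖ ≤ _
  rw [P.norm_toH (hm x)]
  exact (h _ x.mem).2

lemma exM (n : ℕ) : ∃ M : P.H n →L[ℂ] P.H n →L[ℂ] P.H n,
    ∀ x y, EqOn (M x y).fn (x.fn * y.fn) P.I := by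
  obtain ⟨C, hC, h⟩ := P.mm_mul n
  have hm : ∀ x y : P.H n, P.mm n (x.fn * y.fn) := fun x y => (h _ _ x.mem y.mem).1
  let M0 : P.H n →ₗ[ℂ] P.H n →ₗ[ℂ] P.H n := LinearMap.mk₂ ℂ (fun x y => P.toH n (x.fn * y.fn))
    (fun x y z => H.ext' fun t ht => (P.toH_fn (hm (x + y) z) ht).trans
      ((add_mul (x.fn t) (y.fn t) (z.fn t)).trans
        (congrArg₂ (· + ·) (P.toH_fn (hm x z) ht) (P.toH_fn (hm y z) ht)).symm))
    (fun c x y => H.ext' fun t ht => (P.toH_fn (hm (c • x) y) ht).trans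
      ((smul_mul_assoc c (x.fn t) (y.fn t)).trans
        (congrArg (c • ·) (P.toH_fn (hm x y) ht)).symm))
    (fun x y z => H.ext' fun t ht => (P.toH_fn (hm x (y + z)) ht).trans
      ((mul_add (x.fn t) (y.fn t) (z.fn t)).trans
        (congrArg₂ (· + ·) (P.toH_fn (hm x y) ht) (P.toH_fn (hm x z) ht)).symm))
    (fun c x y => H.ext' fun t ht => (P.toH_fn (hm x (c • y)) ht).trans
      ((mul_smul_comm c (x.fn t) (y.fn t)).trans
        (congrArg (c • ·) (P.toH_fn (hm x y) ht)).symm))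
  refine ⟨M0.mkContinuous₂ C fun x y => ?_, fun x y => P.toH_fn (hm x y)⟩
  change ‖P.toH n _‖ ≤ _
  rw [P.norm_toH (hm x y), mul_assoc]
  exact (h _ _ x.mem y.mem).2

end HPar


namespace HPar

variable (P : HPar)

/-- the operator `L` as a function of its coefficients -/
lemma exL (n r m : ℕ) : ∃ Lm : (Fin r → Fin m → Fin m → P.H n) →
      ((Fin m → P.H (n + r)) →L[ℂ] (Fin m → P.H n)),
    Continuous Lm ∧
    (∀ c x i, EqOn (Lm c x i).fn (fun t => iteratedDerivWithin r (x i).fn P.I t +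
      ∑ j, ∑ k, (c j i k).fn t * iteratedDerivWithin (j : ℕ) (x k).fn P.I t) P.I) ∧
    ∀ (l : Filter ℝ) (c : ℝ → Fin r → Fin m → Fin m → P.H n) c0,
      (∀ x, Tendsto (fun ε => Lm (c ε) x) l (𝓝 (Lm c0 x))) → Tendsto c l (𝓝 c0) := by
  classical
  obtain ⟨Dr, hDr⟩ := P.exD n r r le_rfl
  choose D hD using fun j : Fin r => P.exD n r j j.2.le
  obtain ⟨M, hM⟩ := P.exM n
  let Lm : (Fin r → Fin m → Fin m → P.H n) →
      ((Fin m → P.H (n + r)) →L[ℂ] (Fin m → P.H n)) := fun c =>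
    ∑ i, (ContinuousLinearMap.single ℂ (fun _ : Fin m => P.H n) i).comp
      (Dr.comp (ContinuousLinearMap.proj i) +
        ∑ j, ∑ k, (M (c j i k)).comp ((D j).comp (ContinuousLinearMap.proj k)))
  have happ : ∀ c x i, Lm c x i = Dr (x i) + ∑ j, ∑ k, M (c j i k) (D j (x k)) := by
    intro c x i
    simp only [Lm, _root_.sum_apply, Finset.sum_apply, ContinuousLinearMap.comp_apply,
      ContinuousLinearMap.single_apply, _root_.add_apply,
      ContinuousLinearMap.proj_apply]
    rw [Finset.sum_eq_single i]
    · rw [Pi.single_eq_same]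
    · intro b _ hb
      rw [Pi.single_eq_of_ne (Ne.symm hb)]
    · simp
  have hsum : ∀ {ι : Type} (s : Finset ι) (f : ι → P.H n) (t : ℝ),
      (∑ a ∈ s, f a).fn t = ∑ a ∈ s, (f a).fn t := by
    intro ι s f t
    induction s using Finset.induction_on with
    | empty => simp
    | insert a s ha ih => rw [Finset.sum_insert ha, Finset.sum_insert ha, H.fn_add, Pi.add_apply, ih]
  refine ⟨Lm, ?_, ?_, ?_⟩
  · refine continuous_finsetSum _ fun i _ => ?_
    refine continuous_const.clm_comp (continuous_const.add ?_)
    refine continuous_finsetSum _ fun j _ => continuous_finsetSum _ fun k _ => ?_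
    refine Continuous.clm_comp ?_ continuous_const
    exact M.continuous.comp ((continuous_apply k).comp ((continuous_apply i).comp
      (continuous_apply j)))
  · intro c x i t ht
    rw [happ, H.fn_add, Pi.add_apply, hDr _ ht, hsum]
    congr 1
    refine Finset.sum_congr rfl fun j _ => ?_
    rw [hsum]
    refine Finset.sum_congr rfl fun k _ => ?_
    rw [hM _ _ ht, Pi.mul_apply, hD _ _ ht]
  · intro l c c0 h
    have key : ∀ N : ℕ, ∀ j : Fin r, (j : ℕ) = N → ∀ i k,
        Tendsto (fun ε => c ε j i k) l (𝓝 (c0 j i k)) := by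
      intro N
      induction N using Nat.strong_induction_on with
      | _ N ih =>
        intro j hj i k
        let μ : P.H (n + r) := P.toH (n + r) (mono j)
        have hμ : EqOn μ.fn (mono j) P.I := P.toH_fn (P.mm_mono _ _)
        let x : Fin m → P.H (n + r) := Pi.single k μ
        have hDj : ∀ j' : Fin r, j < j' → D j' μ = 0 := by
          intro j' hjj
          refine H.ext' fun t ht => ?_
          rw [hD _ _ ht, iteratedDerivWithin_congr hμ ht]
          obtain ⟨q, hq⟩ := Nat.exists_eq_add_of_lt (show (j : ℕ) < j' from hjj)
          have := P.mono_id j (q + 1) ht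
          rw [if_neg (by omega)] at this
          rw [hq]; exact this
        have hD1 : ∀ t ∈ P.I, (D j μ).fn t = 1 := by
          intro t ht
          rw [hD _ _ ht, iteratedDerivWithin_congr hμ ht]
          have := P.mono_id j 0 ht
          rw [if_pos rfl] at this
          exact this
        have hMj : ∀ z, M z (D j μ) = z := by
          intro z
          refine H.ext' fun t ht => ?_
          rw [hM _ _ ht, Pi.mul_apply, hD1 t ht, mul_one]
        have hL : ∀ c : Fin r → Fin m → Fin m → P.H n, c j i k = Lm c x i - Dr (x i) -
            ∑ j', (if j' < j then M (c j' i k) (D j' μ) else 0) := by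
          intro c
          have e1 : ∀ j', ∑ k', M (c j' i k') (D j' (x k')) = M (c j' i k) (D j' μ) := by
            intro j'
            rw [Finset.sum_eq_single k]
            · simp only [x, Pi.single_eq_same]
            · intro b _ hb
              simp only [x, Pi.single_eq_of_ne hb, map_zero]
            · simp
          have e2 : ∑ j', M (c j' i k) (D j' μ) =
              ∑ j', ((if j' < j then M (c j' i k) (D j' μ) else 0) +
                (if j' = j then c j i k else 0)) := by
            refine Finset.sum_congr rfl fun j' _ => ?_
            rcases lt_trichotomy j' j with h | h | h
            · rw [if_pos h, if_neg h.ne, add_zero]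
            · subst h; rw [if_neg (lt_irrefl _), if_pos rfl, zero_add, hMj]
            · rw [if_neg h.not_gt, if_neg h.ne', add_zero, hDj _ h, map_zero]
          rw [happ, Finset.sum_congr rfl fun j' _ => e1 j', e2, Finset.sum_add_distrib,
            Finset.sum_ite_eq' Finset.univ j]
          simp only [Finset.mem_univ, if_true]
          abel
        rw [hL c0]
        refine Tendsto.congr (fun ε => (hL (c ε)).symm) ?_
        refine Tendsto.sub (Tendsto.sub ?_ tendsto_const_nhds) ?_
        · exact ((continuous_apply i).tendsto _).comp (h x)
        · refine tendsto_finsetSum _ fun j' _ => ?_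
          by_cases hjj : j' < j
          · simp only [if_pos hjj]
            have h1 := ih j' (by rw [← hj]; exact hjj) j' rfl i k
            have h2 : Continuous fun z : P.H n => M z (D j' μ) :=
              M.continuous.clm_apply continuous_const
            exact (h2.tendsto _).comp h1
          · simp only [if_neg hjj]; exact tendsto_const_nhds
    exact tendsto_pi_nhds.2 fun j => tendsto_pi_nhds.2 fun i => tendsto_pi_nhds.2 fun k =>
      key j j rfl i k

/-- underlying vector function -/
def vec {P : HPar} {N k : ℕ} (x : Fin k → P.H N) : ℝ → Fin k → ℂ := fun t i => (x i).fn t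

def toV (N : ℕ) {k : ℕ} (y : ℝ → Fin k → ℂ) : Fin k → P.H N := fun i => P.toH N (fun t => y t i)

lemma vec_mem {N k : ℕ} (x : Fin k → P.H N) : vHolMem P.a P.b N P.α (vec x) :=
  fun i => (P.holMem_iff _ _).2 (x i).mem

lemma vec_norm {N k : ℕ} (x : Fin k → P.H N) : vHolNorm P.a P.b N P.α (vec x) = ∑ i, ‖x i‖ :=
  Finset.sum_congr rfl fun i _ => P.holNorm_eq _ _

lemma le_vec_norm {N k : ℕ} (x : Fin k → P.H N) : ‖x‖ ≤ vHolNorm P.a P.b N P.α (vec x) := by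
  rw [vec_norm]
  refine (pi_norm_le_iff_of_nonneg (Finset.sum_nonneg fun i _ => norm_nonneg _)).2 fun i => ?_
  exact Finset.single_le_sum (f := fun i => ‖x i‖) (fun i _ => norm_nonneg _) (Finset.mem_univ i)

lemma vec_norm_le {N k : ℕ} (x : Fin k → P.H N) : vHolNorm P.a P.b N P.α (vec x) ≤ k * ‖x‖ := by
  rw [vec_norm]
  refine (Finset.sum_le_sum fun i _ => norm_le_pi_norm x i).trans ?_
  simp

lemma vnorm_congr {N k : ℕ} {y z : ℝ → Fin k → ℂ} (h : EqOn y z P.I) :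
    vHolNorm P.a P.b N P.α y = vHolNorm P.a P.b N P.α z :=
  Finset.sum_congr rfl fun i _ => by
    rw [P.holNorm_eq, P.holNorm_eq]
    exact P.nm_congr fun t ht => congrFun (h ht) i

lemma vmem_congr {N k : ℕ} {y z : ℝ → Fin k → ℂ} (h : EqOn y z P.I)
    (hy : vHolMem P.a P.b N P.α y) : vHolMem P.a P.b N P.α z := fun i =>
  (P.holMem_iff _ _).2 (P.mm_congr (fun _ ht => congrFun (h ht) i) ((P.holMem_iff _ _).1 (hy i)))

lemma vec_toV {N k : ℕ} {y : ℝ → Fin k → ℂ} (hy : vHolMem P.a P.b N P.α y) :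
    EqOn (vec (P.toV N y)) y P.I := fun t ht => funext fun i =>
  P.toH_fn ((P.holMem_iff _ _).1 (hy i)) ht

lemma vec_ext {N k : ℕ} {x y : Fin k → P.H N} (h : EqOn (vec x) (vec y) P.I) : x = y :=
  funext fun i => H.ext' fun _ ht => congrFun (h ht) i

lemma vec_sub {N k : ℕ} (x y : Fin k → P.H N) : vec (x - y) = vec x - vec y := rfl

lemma Lop_congr {r m : ℕ} {A : Fin r → ℝ → Matrix (Fin m) (Fin m) ℂ} {y z : ℝ → Fin m → ℂ}
    (h : EqOn y z P.I) : EqOn (Lop P.a P.b r A y) (Lop P.a P.b r A z) P.I := by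
  intro t ht
  have : ∀ p, vDeriv P.a P.b p y t = vDeriv P.a P.b p z t := fun p => funext fun i =>
    iteratedDerivWithin_congr (fun s hs => congrFun (h hs) i) ht
  simp only [Lop, this]

lemma B_congr {N k q : ℕ} {B : (ℝ → (Fin k → ℂ)) →ₗ[ℂ] (Fin q → ℂ)} {K : ℝ}
    (hB : ∀ y : ℝ → (Fin k → ℂ),
      vHolMem P.a P.b N P.α y → ‖B y‖ ≤ K * vHolNorm P.a P.b N P.α y)
    {y z : ℝ → Fin k → ℂ} (h : EqOn y z P.I) : B y = B z := by
  have h0 : EqOn (vec (0 : Fin k → P.H N)) (y - z) P.I := fun t ht => by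
    rw [Pi.sub_apply, h ht, sub_self]; rfl
  have h1 := hB (y - z) (P.vmem_congr h0 (P.vec_mem _))
  rw [← P.vnorm_congr h0, vec_norm] at h1
  simp only [Pi.zero_apply, norm_zero, Finset.sum_const_zero, mul_zero, map_sub] at h1
  exact sub_eq_zero.1 (norm_le_zero_iff.1 h1)

end HPar


namespace HPar

variable (P : HPar)

/-- `(L, B)` on the Banach-space level represents the concrete operators. -/
structure Rep (n r m : ℕ) (A : Fin r → ℝ → Matrix (Fin m) (Fin m) ℂ)
    (B : (ℝ → (Fin m → ℂ)) →ₗ[ℂ] (Fin (r * m) → ℂ))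
    (L : (Fin m → P.H (n + r)) →L[ℂ] (Fin m → P.H n))
    (Bc : (Fin m → P.H (n + r)) →L[ℂ] (Fin (r * m) → ℂ)) : Prop where
  hL : ∀ x, EqOn (vec (L x)) (Lop P.a P.b r A (vec x)) P.I
  hBc : ∀ x, Bc x = B (vec x)
  hcongr : ∀ y z : ℝ → Fin m → ℂ, EqOn y z P.I → B y = B z

variable {P} {n r m : ℕ} {A : Fin r → ℝ → Matrix (Fin m) (Fin m) ℂ}
  {B : (ℝ → (Fin m → ℂ)) →ₗ[ℂ] (Fin (r * m) → ℂ)}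
  {L : (Fin m → P.H (n + r)) →L[ℂ] (Fin m → P.H n)}
  {Bc : (Fin m → P.H (n + r)) →L[ℂ] (Fin (r * m) → ℂ)}

lemma Rep.fwd (R : P.Rep n r m A B L Bc) {f : ℝ → Fin m → ℂ} {c : Fin (r * m) → ℂ}
    {y : ℝ → Fin m → ℂ} (hf : vHolMem P.a P.b n P.α f) (h : IsSol P.a P.b n P.α r m A B f c y) :
    L (P.toV (n + r) y) = P.toV n f ∧ Bc (P.toV (n + r) y) = c := by
  obtain ⟨h1, h2, h3⟩ := h
  have hy := P.vec_toV h1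
  refine ⟨P.vec_ext fun t ht => ?_, ?_⟩
  · rw [R.hL _ ht, P.Lop_congr hy ht, h2 t ht, P.vec_toV hf ht]
  · rw [R.hBc, R.hcongr _ _ hy, h3]

lemma Rep.bwd (R : P.Rep n r m A B L Bc) {f : ℝ → Fin m → ℂ} {c : Fin (r * m) → ℂ}
    {x : Fin m → P.H (n + r)} (hf : vHolMem P.a P.b n P.α f)
    (h1 : L x = P.toV n f) (h2 : Bc x = c) : IsSol P.a P.b n P.α r m A B f c (vec x) := by
  refine ⟨P.vec_mem x, fun t ht => ?_, ?_⟩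
  · rw [← R.hL _ ht, h1, P.vec_toV hf ht]
  · rw [← R.hBc, h2]

/-- concrete invertibility -/
def Inv (P : HPar) (n r m : ℕ) (A : Fin r → ℝ → Matrix (Fin m) (Fin m) ℂ)
    (B : (ℝ → (Fin m → ℂ)) →ₗ[ℂ] (Fin (r * m) → ℂ)) : Prop :=
  (∀ f : ℝ → (Fin m → ℂ), vHolMem P.a P.b n P.α f → ∀ c : Fin (r * m) → ℂ,
        ∃ y, IsSol P.a P.b n P.α r m A B f c y ∧
          ∀ y', IsSol P.a P.b n P.α r m A B f c y' → Set.EqOn y' y (Set.Icc P.a P.b)) ∧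
      ∃ κ : ℝ, 0 < κ ∧ ∀ f : ℝ → (Fin m → ℂ), ∀ c : Fin (r * m) → ℂ,
        ∀ y : ℝ → (Fin m → ℂ), vHolMem P.a P.b n P.α f → IsSol P.a P.b n P.α r m A B f c y →
          vHolNorm P.a P.b (n + r) P.α y ≤ κ * (vHolNorm P.a P.b n P.α f + ‖c‖)

lemma toV_vec {N k : ℕ} (x : Fin k → P.H N) : P.toV N (vec x) = x :=
  P.vec_ext (P.vec_toV (P.vec_mem x))

lemma Rep.of_inv (R : P.Rep n r m A B L Bc) (h : P.Inv n r m A B) :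
    (∀ f c, ∃ x, L x = f ∧ Bc x = c) ∧ ∃ κ : ℝ, ∀ x, ‖x‖ ≤ κ * (‖L x‖ + ‖Bc x‖) := by
  obtain ⟨h1, κ, hκ, h2⟩ := h
  constructor
  · intro f c
    obtain ⟨y, hy, -⟩ := h1 (vec f) (P.vec_mem f) c
    have := R.fwd (P.vec_mem f) hy
    rw [toV_vec] at this
    exact ⟨_, this⟩
  · refine ⟨κ * (m + 1), fun x => ?_⟩
    have hs := R.bwd (f := vec (L x)) (P.vec_mem _) (toV_vec _).symm rfl
    have h3 := h2 _ _ _ (P.vec_mem _) hs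
    have h4 := P.vec_norm_le (L x)
    have h5 := P.le_vec_norm x
    refine h5.trans (h3.trans ?_)
    rw [mul_assoc]
    refine mul_le_mul_of_nonneg_left ?_ hκ.le
    have : (0:ℝ) ≤ m * ‖Bc x‖ := by positivity
    nlinarith [norm_nonneg (L x)]

lemma Rep.to_inv (R : P.Rep n r m A B L Bc) (h : ∀ f c, ∃ x, L x = f ∧ Bc x = c) {M : ℝ}
    (hM0 : 0 < M) (hM : ∀ x, ‖x‖ ≤ M * (‖L x‖ + ‖Bc x‖)) : P.Inv n r m A B := by
  constructor
  · intro f hf c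
    obtain ⟨x, hx, hc⟩ := h (P.toV n f) c
    refine ⟨vec x, R.bwd hf hx hc, fun y' hy' => ?_⟩
    obtain ⟨h1, h2⟩ := R.fwd hf hy'
    have h3 := hM (P.toV (n + r) y' - x)
    rw [map_sub, map_sub, h1, h2, hx, hc, sub_self, sub_self, norm_zero, norm_zero, add_zero,
      mul_zero, norm_le_zero_iff, sub_eq_zero] at h3
    rw [← h3]
    exact (P.vec_toV hy'.1).symm
  · refine ⟨(m + 1) * M, by positivity, fun f c y hf hy => ?_⟩
    obtain ⟨h1, h2⟩ := R.fwd hf hy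
    have h3 := hM (P.toV (n + r) y)
    rw [h1, h2] at h3
    have h4 := P.le_vec_norm (P.toV n f)
    rw [P.vnorm_congr (P.vec_toV hf)] at h4
    have h5 := P.vec_norm_le (P.toV (n + r) y)
    rw [P.vnorm_congr (P.vec_toV hy.1)] at h5
    refine h5.trans ?_
    rw [mul_assoc]
    have h6 : ‖P.toV (n + r) y‖ ≤ M * (vHolNorm P.a P.b n P.α f + ‖c‖) :=
      h3.trans (by gcongr)
    calc (m : ℝ) * ‖P.toV (n + r) y‖ ≤ (m + 1) * ‖P.toV (n + r) y‖ := by gcongr; linarith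
      _ ≤ _ := by gcongr

theorem main_P (P : HPar) (n m r : ℕ) (ε₀ : ℝ) (hε₀ : 0 < ε₀)
    (A : ℝ → Fin r → ℝ → Matrix (Fin m) (Fin m) ℂ)
    (hA : ∀ ε ∈ Set.Ico (0 : ℝ) ε₀, ∀ j, mHolMem P.a P.b n P.α (A ε j))
    (B : ℝ → (ℝ → (Fin m → ℂ)) →ₗ[ℂ] (Fin (r * m) → ℂ))
    (hB : ∀ ε ∈ Set.Ico (0 : ℝ) ε₀, ∃ K : ℝ, ∀ y : ℝ → (Fin m → ℂ),
      vHolMem P.a P.b (n + r) P.α y → ‖B ε y‖ ≤ K * vHolNorm P.a P.b (n + r) P.α y)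
    (hstrong : ∀ y : ℝ → (Fin m → ℂ), vHolMem P.a P.b (n + r) P.α y →
      Tendsto (fun ε => vHolNorm P.a P.b n P.α
        (fun t => Lop P.a P.b r (A ε) y t - Lop P.a P.b r (A 0) y t))
        (nhdsWithin 0 (Set.Ioi 0)) (nhds 0) ∧
      Tendsto (fun ε => B ε y) (nhdsWithin 0 (Set.Ioi 0)) (nhds (B 0 y)))
    (hinv0 : P.Inv n r m (A 0) (B 0)) :
    ∃ ε₁ : ℝ, 0 < ε₁ ∧ ε₁ < ε₀ ∧
      (∀ ε ∈ Set.Ico (0 : ℝ) ε₁, P.Inv n r m (A ε) (B ε)) ∧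
      (∀ f : ℝ → (Fin m → ℂ), vHolMem P.a P.b n P.α f → ∀ c : Fin (r * m) → ℂ,
        ∀ y : ℝ → ℝ → (Fin m → ℂ),
          (∀ ε ∈ Set.Ico (0 : ℝ) ε₁, IsSol P.a P.b n P.α r m (A ε) (B ε) f c (y ε)) →
          Tendsto (fun ε => vHolNorm P.a P.b (n + r) P.α (fun t => y ε t - y 0 t))
            (nhdsWithin 0 (Set.Ioi 0)) (nhds 0)) := by
  obtain ⟨Lm, hLc, hLf, hLx⟩ := P.exL n r m
  let cf : ℝ → Fin r → Fin m → Fin m → P.H n := fun ε j i k => P.toH n (fun t => A ε j t i k)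
  have exB : ∀ ε, ∃ Bc : (Fin m → P.H (n + r)) →L[ℂ] (Fin (r * m) → ℂ),
      ε ∈ Set.Ico (0 : ℝ) ε₀ → ∀ x, Bc x = B ε (vec x) := by
    intro ε
    by_cases hε : ε ∈ Set.Ico (0 : ℝ) ε₀
    · obtain ⟨K, hK⟩ := hB ε hε
      let B0 : (Fin m → P.H (n + r)) →ₗ[ℂ] (Fin (r * m) → ℂ) :=
        { toFun := fun x => B ε (vec x)
          map_add' := fun x y => (B ε).map_add (vec x) (vec y)
          map_smul' := fun c x => (B ε).map_smul c (vec x) }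
      refine ⟨B0.mkContinuous (|K| * m) fun x => ?_, fun _ x => rfl⟩
      refine (hK (vec x) (P.vec_mem x)).trans ?_
      have h1 := P.vec_norm_le x
      have h2 := (norm_nonneg _).trans (P.le_vec_norm x)
      rw [mul_assoc]
      exact (mul_le_mul_of_nonneg_right (le_abs_self K) h2).trans
        (mul_le_mul_of_nonneg_left h1 (abs_nonneg K))
    · exact ⟨0, fun h => absurd h hε⟩
  choose Bc hBc using exB
  have rep : ∀ ε ∈ Set.Ico (0 : ℝ) ε₀, P.Rep n r m (A ε) (B ε) (Lm (cf ε)) (Bc ε) := by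
    intro ε hε
    refine ⟨fun x t ht => funext fun i => ?_, hBc ε hε, fun y z h => ?_⟩
    · have h1 := hLf (cf ε) x i ht
      refine h1.trans ?_
      simp only [Lop, Pi.add_apply, Finset.sum_apply, Matrix.mulVec, dotProduct]
      refine congrArg₂ (· + ·) rfl (Finset.sum_congr rfl fun j _ => Finset.sum_congr rfl
        fun k _ => congrArg₂ (· * ·) ?_ rfl)
      exact P.toH_fn ((P.holMem_iff _ _).1 (hA ε hε j i k)) ht
    · obtain ⟨K, hK⟩ := hB ε hε
      exact P.B_congr hK h
  have h0 : (0 : ℝ) ∈ Set.Ico (0 : ℝ) ε₀ := ⟨le_rfl, hε₀⟩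
  have hev : ∀ᶠ ε in 𝓝[>] (0 : ℝ), ε ∈ Set.Ico (0 : ℝ) ε₀ := by
    filter_upwards [Ioo_mem_nhdsGT hε₀] with ε hε using ⟨hε.1.le, hε.2⟩
  have hBs : ∀ x, Tendsto (fun ε => Bc ε x) (𝓝[>] 0) (𝓝 (Bc 0 x)) := by
    intro x
    rw [hBc 0 h0]
    refine (hstrong (vec x) (P.vec_mem x)).2.congr' ?_
    filter_upwards [hev] with ε hε using (hBc ε hε x).symm
  have hLs : ∀ x, Tendsto (fun ε => Lm (cf ε) x) (𝓝[>] 0) (𝓝 (Lm (cf 0) x)) := by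
    intro x
    refine tendsto_iff_norm_sub_tendsto_zero.2 ?_
    refine squeeze_zero' (Eventually.of_forall fun _ => norm_nonneg _) ?_
      (hstrong (vec x) (P.vec_mem x)).1
    filter_upwards [hev] with ε hε
    refine (P.le_vec_norm _).trans (P.vnorm_congr fun t ht => ?_).le
    rw [vec_sub, Pi.sub_apply, (rep ε hε).hL x ht, (rep 0 h0).hL x ht]
  have hcf := hLx _ cf (cf 0) hLs
  have hLn : Tendsto (fun ε => Lm (cf ε)) (𝓝[>] 0) (𝓝 (Lm (cf 0))) :=
    (hLc.tendsto _).comp hcf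
  obtain ⟨hsurj, κ, hκ⟩ := (rep 0 h0).of_inv hinv0
  obtain ⟨M, hM0, hM⟩ := abs_main (fun ε => Lm (cf ε)) Bc hLn hBs hsurj κ hκ
  obtain ⟨δ, hδ, hδs⟩ := mem_nhdsGT_iff_exists_Ioo_subset.1 hM
  have hδ0 : 0 < δ := hδ
  refine ⟨min δ (ε₀ / 2), lt_min hδ0 (by linarith),
    (min_le_right _ _).trans_lt (by linarith), ?_, ?_⟩
  · intro ε hε
    rcases hε.1.eq_or_lt with h | h
    · rw [← h]; exact hinv0
    · have h1 := hδs ⟨h, hε.2.trans_le (min_le_left _ _)⟩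
      have h2 : ε ∈ Set.Ico (0 : ℝ) ε₀ :=
        ⟨h.le, (hε.2.trans_le (min_le_right _ _)).trans (by linarith)⟩
      exact (rep ε h2).to_inv h1.1 hM0 h1.2
  · intro f hf c y hy
    have hpos : 0 < min δ (ε₀ / 2) := lt_min hδ0 (by linarith)
    have hy0 := hy 0 ⟨le_rfl, hpos⟩
    obtain ⟨e1, e2⟩ := (rep 0 h0).fwd hf hy0
    set x0 := P.toV (n + r) (y 0) with hx0
    have hlim : Tendsto (fun ε => (m : ℝ) * (M * (‖Lm (cf ε) x0 - Lm (cf 0) x0‖ +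
        ‖Bc ε x0 - Bc 0 x0‖))) (𝓝[>] 0) (𝓝 0) := by
      have h1 := tendsto_iff_norm_sub_tendsto_zero.1 (hLs x0)
      have h2 := tendsto_iff_norm_sub_tendsto_zero.1 (hBs x0)
      simpa using ((h1.add h2).const_mul M).const_mul (m : ℝ)
    have hev2 : ∀ᶠ ε in 𝓝[>] (0 : ℝ), vHolNorm P.a P.b (n + r) P.α (fun t => y ε t - y 0 t) =
        vHolNorm P.a P.b (n + r) P.α (vec (P.toV (n + r) (y ε) - x0)) := by
      filter_upwards [Ioo_mem_nhdsGT hpos] with ε hε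
      have hyε := hy ε ⟨hε.1.le, hε.2⟩
      refine P.vnorm_congr fun t ht => ?_
      rw [vec_sub, Pi.sub_apply, P.vec_toV hyε.1 ht, hx0, P.vec_toV hy0.1 ht]
    refine squeeze_zero' ?_ ?_ hlim
    · filter_upwards [hev2] with ε hε
      rw [hε]
      exact (norm_nonneg _).trans (P.le_vec_norm _)
    · filter_upwards [hev2, Ioo_mem_nhdsGT hpos, hev, hM] with ε h1 h2 h3 h4
      rw [h1]
      refine (P.vec_norm_le _).trans ?_
      refine mul_le_mul_of_nonneg_left ?_ (Nat.cast_nonneg m)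
      refine (h4.2 _).trans ?_
      obtain ⟨g1, g2⟩ := (rep ε h3).fwd hf (hy ε ⟨h2.1.le, h2.2⟩)
      rw [map_sub, map_sub, g1, g2, e1, e2, norm_sub_rev, norm_sub_rev c]

end HPar


/-- If (L(ε), B(ε)) converges strongly to (L(0), B(0)) as ε → 0+ and the limit operator
is invertible, then (L(ε), B(ε)) is invertible for all small ε ≥ 0 and the inverses
converge strongly to the inverse of the limit operator. -/
theorem strong_convergence_with_invertible_limit
    (a b : ℝ) (hab : a < b) (n : ℕ) (α : ℝ) (hα0 : 0 < α) (hα1 : α ≤ 1)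
    (m r : ℕ) (hm : 1 ≤ m) (hr : 2 ≤ r) (ε₀ : ℝ) (hε₀ : 0 < ε₀)
    (A : ℝ → Fin r → ℝ → Matrix (Fin m) (Fin m) ℂ)
    (hA : ∀ ε ∈ Set.Ico (0 : ℝ) ε₀, ∀ j, mHolMem a b n α (A ε j))
    (B : ℝ → (ℝ → (Fin m → ℂ)) →ₗ[ℂ] (Fin (r * m) → ℂ))
    (hB : ∀ ε ∈ Set.Ico (0 : ℝ) ε₀, ∃ K : ℝ, ∀ y : ℝ → (Fin m → ℂ),
      vHolMem a b (n + r) α y → ‖B ε y‖ ≤ K * vHolNorm a b (n + r) α y)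
    (hstrong : ∀ y : ℝ → (Fin m → ℂ), vHolMem a b (n + r) α y →
      Tendsto (fun ε => vHolNorm a b n α (fun t => Lop a b r (A ε) y t - Lop a b r (A 0) y t))
        (nhdsWithin 0 (Set.Ioi 0)) (nhds 0) ∧
      Tendsto (fun ε => B ε y) (nhdsWithin 0 (Set.Ioi 0)) (nhds (B 0 y)))
    (hinv0 : (∀ f : ℝ → (Fin m → ℂ), vHolMem a b n α f → ∀ c : Fin (r * m) → ℂ,
        ∃ y, IsSol a b n α r m (A 0) (B 0) f c y ∧
          ∀ y', IsSol a b n α r m (A 0) (B 0) f c y' → Set.EqOn y' y (Set.Icc a b)) ∧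
      ∃ κ : ℝ, 0 < κ ∧ ∀ f : ℝ → (Fin m → ℂ), ∀ c : Fin (r * m) → ℂ,
        ∀ y : ℝ → (Fin m → ℂ), vHolMem a b n α f → IsSol a b n α r m (A 0) (B 0) f c y →
          vHolNorm a b (n + r) α y ≤ κ * (vHolNorm a b n α f + ‖c‖)) :
    ∃ ε₁ : ℝ, 0 < ε₁ ∧ ε₁ < ε₀ ∧
      (∀ ε ∈ Set.Ico (0 : ℝ) ε₁,
        (∀ f : ℝ → (Fin m → ℂ), vHolMem a b n α f → ∀ c : Fin (r * m) → ℂ,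
          ∃ y, IsSol a b n α r m (A ε) (B ε) f c y ∧
            ∀ y', IsSol a b n α r m (A ε) (B ε) f c y' → Set.EqOn y' y (Set.Icc a b)) ∧
        ∃ κ : ℝ, 0 < κ ∧ ∀ f : ℝ → (Fin m → ℂ), ∀ c : Fin (r * m) → ℂ,
          ∀ y : ℝ → (Fin m → ℂ), vHolMem a b n α f → IsSol a b n α r m (A ε) (B ε) f c y →
            vHolNorm a b (n + r) α y ≤ κ * (vHolNorm a b n α f + ‖c‖)) ∧
      (∀ f : ℝ → (Fin m → ℂ), vHolMem a b n α f → ∀ c : Fin (r * m) → ℂ,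
        ∀ y : ℝ → ℝ → (Fin m → ℂ),
          (∀ ε ∈ Set.Ico (0 : ℝ) ε₁, IsSol a b n α r m (A ε) (B ε) f c (y ε)) →
          Tendsto (fun ε => vHolNorm a b (n + r) α (fun t => y ε t - y 0 t))
            (nhdsWithin 0 (Set.Ioi 0)) (nhds 0)) := by
  exact HPar.main_P ⟨a, b, α, hab, hα0, hα1⟩ n m r ε₀ hε₀ A hA B hB hstrong hinv0
end
end
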